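/- arXiv:2104.14651 — 2 statements merged into one kernel-verified Lean document; each statement's English description precedes it below -/
import Mathlib

section
/- Let (R, m) be an F-finite regular local ring of characteristic p > 0, q = p^e, and a ≥ 1 an integer. For f ∈ R: f ∈ R^q + m^{qa} if and only if D(f) ∈ m^{q(a−1)+1} for every differential operator D of R of order at most q − 1 with D(1) = 0. -/
/-- `IsDiffOp R n D` : `D` is an (absolute) differential operator of `R` of order at most `n`,
defined inductively: order `≤ 0` means `R`-linear, and `D` has order `≤ n+1` if all the
commutators `[D, mulLeft r]` have order `≤ n`.  (For commutative rings this agrees with the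
definition via the left `R`-linear extension of `D` to `R ⊗ R` annihilating `T_R^{n+1}`.) -/
def IsDiffOp (R : Type*) [CommRing R] : ℕ → (R →+ R) → Prop
  | 0, D => ∀ r s : R, D (r * s) = r * D s
  | n + 1, D => ∀ r : R,
      IsDiffOp R n ((D.comp (AddMonoidHom.mulLeft r)) - ((AddMonoidHom.mulLeft r).comp D))


/-- A Noetherian local ring is regular when its maximal ideal is generated by a regular
sequence. -/
def IsRegularLocal (R : Type*) [CommRing R] [IsLocalRing R] : Prop :=
  IsNoetherianRing R ∧ ∃ rs : List R,
    RingTheory.Sequence.IsRegular R rs ∧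
    Ideal.span {x | x ∈ rs} = IsLocalRing.maximalIdeal R


open MvPolynomial in
/-- quasi-regularity of a family -/
def QReg {R : Type*} [CommRing R] {n : ℕ} (x : Fin n → R) : Prop :=
  ∀ (N : ℕ) (F : MvPolynomial (Fin n) R), F.IsHomogeneous N →
    eval x F ∈ Ideal.span (Set.range x) ^ (N + 1) →
    F ∈ Ideal.map C (Ideal.span (Set.range x))

namespace QReg
open MvPolynomial
variable {R : Type*} [CommRing R]

lemma exists_form {n : ℕ} (x : Fin n → R) (N : ℕ) (z : R)
    (hz : z ∈ Ideal.span (Set.range x) ^ N) :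
    ∃ G : MvPolynomial (Fin n) R, G.IsHomogeneous N ∧ eval x G = z := by
  rw [Ideal.mem_span_pow_iff_exists_isHomogeneous] at hz
  obtain ⟨G, hG, h⟩ := hz
  exact ⟨G, hG, h⟩

lemma form_mem {n : ℕ} (x : Fin n → R) (N : ℕ) (G : MvPolynomial (Fin n) R)
    (hG : G.IsHomogeneous N) : eval x G ∈ Ideal.span (Set.range x) ^ N := by
  rw [Ideal.mem_span_pow_iff_exists_isHomogeneous]
  exact ⟨G, hG, rfl⟩

lemma exists_form_succ {n : ℕ} (x : Fin n → R) (N : ℕ) (z : R)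
    (hz : z ∈ Ideal.span (Set.range x) ^ (N + 1)) :
    ∃ G : MvPolynomial (Fin n) R, G.IsHomogeneous N ∧
      G ∈ Ideal.map C (Ideal.span (Set.range x)) ∧ eval x G = z := by
  rw [pow_succ'] at hz
  induction hz using Submodule.mul_induction_on' with
  | mem_mul_mem a ha b hb =>
    obtain ⟨G, hG, rfl⟩ := exists_form x N b hb
    refine ⟨C a * G, by simpa using (isHomogeneous_C _ a).mul hG, ?_, by simp⟩
    exact Ideal.mul_mem_right _ _ (Ideal.mem_map_of_mem C ha)
  | add a _ b _ h1 h2 =>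
    obtain ⟨G, hG, hG', rfl⟩ := h1
    obtain ⟨H, hH, hH', rfl⟩ := h2
    exact ⟨G + H, hG.add hH, add_mem hG' hH', by simp⟩

lemma form_mem_succ {n : ℕ} (x : Fin n → R) (N : ℕ) (G : MvPolynomial (Fin n) R)
    (hG : G.IsHomogeneous N) (hG' : G ∈ Ideal.map C (Ideal.span (Set.range x))) :
    eval x G ∈ Ideal.span (Set.range x) ^ (N + 1) := by
  rw [mem_map_C_iff] at hG'
  rw [G.as_sum, map_sum]
  refine sum_mem fun m hm => ?_
  have : monomial m (coeff m G) = C (coeff m G) * monomial m 1 := by simp [C_mul_monomial]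
  rw [this, map_mul, eval_C, pow_succ']
  refine Ideal.mul_mem_mul (hG' m) (form_mem x N _ ?_)
  apply isHomogeneous_monomial
  have := hG (mem_support_iff.mp hm)
  rw [Finsupp.degree_eq_weight_one]
  exact this

lemma split {n : ℕ} (N : ℕ) (F : MvPolynomial (Fin (n + 1)) R) (hF : F.IsHomogeneous (N + 1)) :
    ∃ (G : MvPolynomial (Fin n) R) (H : MvPolynomial (Fin (n + 1)) R),
      G.IsHomogeneous (N + 1) ∧ H.IsHomogeneous N ∧ F = rename Fin.succ G + X 0 * H := by
  refine ⟨(finSuccEquiv R n F).coeff 0, (finSuccEquiv R n).symm (finSuccEquiv R n F).divX,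
    ?_, ?_, ?_⟩
  · exact hF.finSuccEquiv_coeff_isHomogeneous 0 (N + 1) (by simp)
  · intro m hm
    have : coeff m ((finSuccEquiv R n).symm (finSuccEquiv R n F).divX)
        = coeff (m + Finsupp.single 0 1) F := by
      obtain ⟨i, m', rfl⟩ : ∃ i m', m = Finsupp.cons i m' := ⟨m 0, m.tail, by simp⟩
      rw [← finSuccEquiv_coeff_coeff, AlgEquiv.apply_symm_apply, Polynomial.coeff_divX,
        finSuccEquiv_coeff_coeff]
      congr 1
      ext j
      refine Fin.cases ?_ (fun j => ?_) j <;> simp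
    rw [this] at hm
    have := hF hm
    rw [map_add, Finsupp.weight_single] at this
    simpa using this
  · have hren : ∀ G : MvPolynomial (Fin n) R,
        finSuccEquiv R n (rename Fin.succ G) = Polynomial.C G := by
      intro G
      induction G using MvPolynomial.induction_on with
      | C a => simp [finSuccEquiv_apply]
      | add a b ha hb => simp [ha, hb]
      | mul_X a i ha => rw [map_mul, map_mul, ha, rename_X, finSuccEquiv_X_succ, map_mul]
    apply (finSuccEquiv R n).injective
    rw [map_add, map_mul, AlgEquiv.apply_symm_apply, finSuccEquiv_X_zero,
      hren]
    exact ((add_comm _ _).trans (Polynomial.X_mul_divX_add _)).symm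

lemma nzd_pow {n : ℕ} {x : Fin n → R} (hx : QReg x) (r : R)
    (hr : ∀ a, r * a ∈ Ideal.span (Set.range x) → a ∈ Ideal.span (Set.range x)) (N : ℕ) (a : R)
    (ha : r * a ∈ Ideal.span (Set.range x) ^ N) : a ∈ Ideal.span (Set.range x) ^ N := by
  induction N with
  | zero => simp
  | succ N ih =>
    obtain ⟨G, hG, rfl⟩ := exists_form x N a (ih (Ideal.pow_le_pow_right (Nat.le_succ N) ha))
    refine form_mem_succ x N G hG ?_
    have := hx N (C r * G) (by simpa using (isHomogeneous_C _ r).mul hG) (by simpa using ha)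
    rw [mem_map_C_iff] at this ⊢
    intro m
    exact hr _ (by simpa using this m)

lemma cons {n : ℕ} {x : Fin n → R} (hx : QReg x) (r : R)
    (hr : ∀ a, r * a ∈ Ideal.span (Set.range x) → a ∈ Ideal.span (Set.range x)) :
    QReg (Fin.cons r x : Fin (n + 1) → R) := by
  set y : Fin (n + 1) → R := Fin.cons r x with hy
  have hle : Ideal.span (Set.range x) ≤ Ideal.span (Set.range y) := by
    apply Ideal.span_mono
    rintro _ ⟨i, rfl⟩
    exact ⟨i.succ, by simp [hy]⟩
  have hry : r ∈ Ideal.span (Set.range y) := Ideal.subset_span ⟨0, by simp [hy]⟩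
  have hys : ∀ G : MvPolynomial (Fin n) R, eval y (rename Fin.succ G) = eval x G := by
    intro G
    rw [eval_rename]
    congr 1
  intro N
  induction N with
  | zero =>
    intro F hF h
    have hc : F = C (coeff 0 F) := by
      rw [← totalDegree_eq_zero_iff_eq_C]
      exact Nat.le_zero.mp hF.totalDegree_le
    rw [hc] at h ⊢
    exact Ideal.mem_map_of_mem _ (by simpa using h)
  | succ N ih =>
    intro F hF h
    obtain ⟨E, hE, hE', hEF⟩ := exists_form_succ y (N + 1) _ h
    suffices hs : F - E ∈ Ideal.map C (Ideal.span (Set.range y)) by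
      simpa using add_mem hs hE'
    obtain ⟨G, H, hG, hH, hGH⟩ := split N (F - E) (hF.sub hE)
    have h0 : eval x G + r * eval y H = 0 := by
      have : eval y (F - E) = 0 := by simp [hEF]
      rw [hGH] at this
      rw [map_add, map_mul, eval_X, hys] at this
      exact this
    have h1 : eval y H ∈ Ideal.span (Set.range x) ^ (N + 1) := by
      apply nzd_pow hx r hr
      rw [eq_neg_of_add_eq_zero_right h0]
      exact neg_mem (form_mem x _ G hG)
    have h2 := ih H hH (Ideal.pow_right_mono hle _ h1)
    obtain ⟨K, hK, hK'⟩ := exists_form x _ _ h1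
    have h3 := hx (N + 1) (G + C r * K)
      (hG.add (by simpa using (isHomogeneous_C _ r).mul hK)) (by simp [hK', h0])
    rw [hGH]
    refine add_mem ?_ (Ideal.mul_mem_left _ _ h2)
    rw [mem_map_C_iff] at h3
    have h4 : G ∈ Ideal.map C (Ideal.span (Set.range y)) := by
      rw [mem_map_C_iff]
      intro m
      have := sub_mem (hle (h3 m)) (Ideal.mul_mem_right (coeff m K) _ hry)
      simpa using this
    have h5 := Ideal.mem_map_of_mem (rename Fin.succ : MvPolynomial (Fin n) R →ₐ[R] MvPolynomial (Fin (n+1)) R).toRingHom h4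
    rw [Ideal.map_map] at h5
    have : ((rename Fin.succ : MvPolynomial (Fin n) R →ₐ[R] MvPolynomial (Fin (n+1)) R).toRingHom).comp C = C := by
      ext; simp
    rwa [this] at h5

lemma of_list (rs : List R) (h : RingTheory.Sequence.IsWeaklyRegular R rs) :
    ∃ (n : ℕ) (x : Fin n → R), Ideal.span (Set.range x) = Ideal.ofList rs ∧ QReg x := by
  induction rs using List.reverseRecOn with
  | nil =>
    refine ⟨0, Fin.elim0, by simp, ?_⟩
    intro N F hF h
    obtain ⟨c, rfl⟩ := C_surjective (Fin 0) F
    apply Ideal.mem_map_of_mem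
    exact Ideal.pow_le_self (Nat.succ_ne_zero N) (by simpa using h)
  | append_singleton rs r ih =>
    rw [RingTheory.Sequence.isWeaklyRegular_append_iff,
      RingTheory.Sequence.isWeaklyRegular_singleton_iff] at h
    obtain ⟨n, x, hx, hq⟩ := ih h.1
    refine ⟨n + 1, Fin.cons r x, ?_, hq.cons r ?_⟩
    · rw [Fin.range_cons, Ideal.span_insert, hx, Ideal.ofList_append, Ideal.ofList_singleton,
        sup_comm]
    · intro a ha
      rw [hx] at ha ⊢
      have h2 := h.2
      rw [isSMulRegular_iff_right_eq_zero_of_smul] at h2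
      have := h2 (Submodule.Quotient.mk a) (by
        rw [← Submodule.Quotient.mk_smul, Submodule.Quotient.mk_eq_zero]
        simpa using ha)
      rw [Submodule.Quotient.mk_eq_zero] at this
      simpa using this
end QReg

namespace IsDiffOp
variable {R : Type*} [CommRing R]

lemma map_pow_mem (I : Ideal R) (n : ℕ) : ∀ (D : R →+ R), IsDiffOp R n D →
    ∀ (N : ℕ) (z : R), z ∈ I ^ N → D z ∈ I ^ (N - n) := by
  induction n with
  | zero =>
    intro D hD N z hz
    have : ∀ z, D z = z * D 1 := fun z => by simpa using hD z 1
    rw [this]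
    exact Ideal.mul_mem_right _ _ (by simpa using hz)
  | succ n ih =>
    intro D hD N
    induction N with
    | zero => intro z hz; simp
    | succ N ihN =>
      intro z hz
      rw [pow_succ'] at hz
      induction hz using Submodule.mul_induction_on' with
      | mem_mul_mem r hr s hs =>
        have h1 := ih _ (hD r) N s hs
        have h2 := ihN s hs
        have h3 : D (r * s) = ((D.comp (AddMonoidHom.mulLeft r)) -
          ((AddMonoidHom.mulLeft r).comp D)) s + r * D s := by simp
        rw [h3]
        refine add_mem (by simpa using h1) ?_
        have h4 := Ideal.mul_mem_mul hr h2
        rw [← pow_succ'] at h4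
        exact Ideal.pow_le_pow_right (by omega) h4
      | add a _ b _ h1 h2 =>
        rw [map_add]
        exact add_mem h1 h2

/-- the operator `D ↦ [D, r]` -/
def adr (r : R) : AddMonoid.End (R →+ R) where
  toFun D := (D.comp (AddMonoidHom.mulLeft r)) - ((AddMonoidHom.mulLeft r).comp D)
  map_zero' := by ext; simp
  map_add' D E := by ext; simp; ring

/-- left multiplication -/
def lm (r : R) : AddMonoid.End (R →+ R) where
  toFun D := (AddMonoidHom.mulLeft r).comp D
  map_zero' := by ext; simp
  map_add' D E := by ext; simp; ring

lemma adr_apply (r : R) (D : R →+ R) (s : R) : adr r D s = D (r * s) - r * D s := rfl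

lemma lm_apply (r : R) (D : R →+ R) (s : R) : lm r D s = r * D s := rfl

lemma lm_pow (r : R) (n : ℕ) (D : R →+ R) (s : R) : ((lm r) ^ n) D s = r ^ n * D s := by
  induction n generalizing D with
  | zero => simp
  | succ n ih =>
    rw [pow_succ]
    change ((lm r) ^ n) (lm r D) s = _
    rw [ih]
    rw [lm_apply]; ring

lemma sum_pow (r : R) (n : ℕ) (D : R →+ R) (s : R) :
    ((adr r + lm r) ^ n) D s = D (r ^ n * s) := by
  induction n generalizing D s with
  | zero => simp
  | succ n ih =>
    rw [pow_succ]
    change ((adr r + lm r) ^ n) ((adr r + lm r) D) s = _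
    rw [ih]
    change adr r D (r ^ n * s) + lm r D (r ^ n * s) = _
    rw [adr_apply, lm_apply, pow_succ', mul_assoc]; ring

lemma adr_pow (r : R) (n : ℕ) (D : R →+ R) (hD : IsDiffOp R n D) : ((adr r) ^ (n + 1)) D = 0 := by
  induction n generalizing D with
  | zero => ext s; rw [zero_add, pow_one, adr_apply, hD r s]; simp
  | succ n ih =>
    rw [pow_succ]
    exact ih _ (hD r)

lemma map_pow_q (p : ℕ) [hp : Fact p.Prime] [CharP R p] (e : ℕ) (D : R →+ R)
    (hD : IsDiffOp R (p ^ e - 1) D) (h1 : D 1 = 0) (r : R) : D (r ^ (p ^ e)) = 0 := by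
  have hq : 0 < p ^ e := pow_pos hp.out.pos e
  have hc : Commute (adr r) (lm r) := by
    ext D s
    change adr r (lm r D) s = lm r (adr r D) s
    simp only [adr_apply, lm_apply]; ring
  have := sum_pow r (p ^ e) D 1
  rw [mul_one] at this
  let ev : AddMonoid.End (R →+ R) →+ R :=
    { toFun := fun T => T D 1, map_zero' := rfl, map_add' := fun _ _ => rfl }
  have hev : ∀ T : AddMonoid.End (R →+ R), T D 1 = ev T := fun _ => rfl
  rw [← this, hev, hc.add_pow, map_sum]
  refine Finset.sum_eq_zero fun m hm => ?_
  rw [← Nat.cast_comm, ← nsmul_eq_mul, map_nsmul]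
  rcases Nat.eq_zero_or_pos m with rfl | hm0
  · rw [pow_zero, one_mul, ← hev, Nat.sub_zero, lm_pow, h1, mul_zero, smul_zero]
  · rcases Nat.lt_or_ge m (p ^ e) with hlt | hge
    · have hd : p ∣ (p ^ e).choose m := hp.out.dvd_choose_pow hm0.ne' hlt.ne
      rw [nsmul_eq_mul, (CharP.cast_eq_zero_iff R p _).mpr hd, zero_mul]
    · have hmq : m = p ^ e := le_antisymm (Nat.lt_succ_iff.mp (Finset.mem_range.mp hm)) hge
      have hz := adr_pow r _ D hD
      rw [Nat.sub_add_cancel hq] at hz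
      rw [hmq, Nat.sub_self, pow_zero, mul_one, ← hev, hz]
      simp
end IsDiffOp

lemma exists_choose {σ : Type*} [DecidableEq σ] (p : ℕ) [Fact p.Prime] (γ : σ → ℕ) (s : Finset σ) :
    ∀ j : ℕ, ¬ p ∣ (∑ i ∈ s, γ i).choose j →
    ∃ α : σ → ℕ, ∑ i ∈ s, α i = j ∧ (∀ i ∉ s, α i = 0) ∧ ∀ i, ¬ p ∣ (γ i).choose (α i) := by
  have hp := (Fact.out : p.Prime)
  induction s using Finset.induction_on with
  | empty =>
    intro j hj
    refine ⟨fun _ => 0, ?_, by simp, fun i => by simpa using hp.ne_one⟩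
    rcases j with _ | j
    · simp
    · simp at hj
  | insert a s ha ih =>
    intro j hj
    rw [Finset.sum_insert ha, Nat.add_choose_eq] at hj
    obtain ⟨⟨u, v⟩, huv, h⟩ : ∃ ij ∈ Finset.HasAntidiagonal.antidiagonal j,
        ¬ p ∣ (γ a).choose ij.1 * (∑ i ∈ s, γ i).choose ij.2 := by
      by_contra hcon
      push Not at hcon
      exact hj (Finset.dvd_sum hcon)
    rw [hp.dvd_mul, not_or] at h
    obtain ⟨α, h1, h2, h3⟩ := ih v h.2
    refine ⟨Function.update α a u, ?_, ?_, ?_⟩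
    · rw [Finset.sum_insert ha, Function.update_self, Finset.sum_update_of_notMem ha, h1]
      simpa using huv
    · intro i hi
      rw [Finset.mem_insert, not_or] at hi
      rw [Function.update_of_ne hi.1, h2 i hi.2]
    · intro i
      by_cases hi : i = a
      · subst hi; simpa using h.1
      · rw [Function.update_of_ne hi]; exact h3 i

lemma choose_mod_q (p : ℕ) [Fact p.Prime] (e n : ℕ) : ¬ p ∣ n.choose (n % p ^ e) := by
  have hp := (Fact.out : p.Prime)
  induction e generalizing n with
  | zero => simpa [Nat.mod_one] using hp.ne_one
  | succ e ih =>
    have h := Choose.choose_modEq_choose_mod_mul_choose_div_nat (n := n) (k := n % p ^ (e + 1)) (p := p)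
    rw [h.dvd_iff dvd_rfl, hp.dvd_mul, not_or]
    have e1 : n % p ^ (e + 1) % p = n % p := Nat.mod_mod_of_dvd _ (dvd_pow_self p (by omega))
    have e2 : n % p ^ (e + 1) / p = (n / p) % p ^ e := by
      rw [pow_succ']
      exact Nat.mod_mul_right_div_self n p (p ^ e)
    rw [e1, e2]
    exact ⟨by simpa using hp.ne_one, ih _⟩

/-- the combinatorial choice -/
lemma exists_alpha {σ : Type*} [Fintype σ] [DecidableEq σ] (p : ℕ) [Fact p.Prime] (e : ℕ) (γ : σ → ℕ)
    (hγ : ∀ i, γ i < p ^ e) (hγ0 : γ ≠ 0) (s : Finset σ) :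
    ∃ α : σ → ℕ, α ≠ 0 ∧ ∑ i, α i < p ^ e ∧ (∑ i ∈ s, γ i) % p ^ e ≤ ∑ i ∈ s, α i ∧
      ∀ i, ¬ p ∣ (γ i).choose (α i) := by
  have hp := (Fact.out : p.Prime)
  by_cases hj : (∑ i ∈ s, γ i) % p ^ e = 0
  · obtain ⟨i, hi⟩ := Function.ne_iff.mp hγ0
    refine ⟨Pi.single i (γ i), by simpa using hi, by simpa using hγ i, by simp [hj], ?_⟩
    intro k
    by_cases hk : k = i
    · subst hk; simpa using hp.ne_one
    · simpa [hk] using hp.ne_one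
  · obtain ⟨α, h1, h2, h3⟩ := exists_choose p γ s _ (choose_mod_q p e (∑ i ∈ s, γ i))
    refine ⟨α, ?_, ?_, h1.ge, h3⟩
    · rintro rfl
      simp at h1
      omega
    · rw [← Finset.sum_subset (Finset.subset_univ s) (fun i _ hi => h2 i hi), h1]
      exact Nat.mod_lt _ (pow_pos hp.pos e)

lemma exists_reduced {R : Type*} [CommRing R] (p : ℕ) [hp : Fact p.Prime] [CharP R p]
    {B : Type*} [CommRing B] [Algebra B R] (hB : ∀ b : B, ∃ c : R, algebraMap B R b = c ^ p)
    {σ : Type*} [Fintype σ] [DecidableEq σ] (y : σ → R) (P : MvPolynomial σ B) :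
    ∃ g : (σ → Fin p) → R, MvPolynomial.aeval y P = ∑ γ, g γ ^ p * ∏ i, y i ^ (γ i : ℕ) := by
  induction P using MvPolynomial.induction_on' with
  | monomial m b =>
    obtain ⟨c, hc⟩ := hB b
    refine ⟨Pi.single (fun i => ⟨m i % p, Nat.mod_lt _ hp.out.pos⟩) (c * ∏ i, y i ^ (m i / p)), ?_⟩
    rw [Finset.sum_eq_single (fun i => ⟨m i % p, Nat.mod_lt _ hp.out.pos⟩)]
    · rw [Pi.single_eq_same, MvPolynomial.aeval_monomial, hc, mul_pow, ← Finset.prod_pow, mul_assoc,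
        ← Finset.prod_mul_distrib, Finsupp.prod_fintype _ _ (by simp)]
      congr 1
      refine Finset.prod_congr rfl fun i _ => ?_
      rw [← pow_mul, ← pow_add]
      congr 1
      simp only
      rw [mul_comm, Nat.div_add_mod]
    · intro γ _ hγ
      rw [Pi.single_eq_of_ne hγ, zero_pow hp.out.ne_zero, zero_mul]
    · simp
  | add P Q hP hQ =>
    obtain ⟨g, hg⟩ := hP
    obtain ⟨h, hh⟩ := hQ
    refine ⟨g + h, ?_⟩
    rw [map_add, hg, hh, ← Finset.sum_add_distrib]
    refine Finset.sum_congr rfl fun γ _ => ?_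
    rw [Pi.add_apply, add_pow_char, add_mul]

/-- p-independent family -/
def PInd {K : Type*} [Field K] (p : ℕ) {r : ℕ} (t : Fin r → K) : Prop :=
  ∀ c : (Fin r → Fin p) → K, ∑ γ, c γ ^ p * ∏ i, t i ^ (γ i : ℕ) = 0 → ∀ γ, c γ = 0

lemma PInd.le {K : Type*} [Field K] (p : ℕ) [hp : Fact p.Prime] [CharP K p]
    [hK : Module.Finite (frobenius K p).fieldRange K] {r : ℕ} (t : Fin r → K) (ht : PInd p t) :
    r ≤ Module.finrank (frobenius K p).fieldRange K := by
  have hli : LinearIndependent (frobenius K p).fieldRange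
      (fun γ : Fin r → Fin p => ∏ i, t i ^ (γ i : ℕ)) := by
    rw [Fintype.linearIndependent_iff]
    intro c hc
    choose d hd using fun γ => (c γ).2
    have := ht d (by
      rw [← hc]
      refine Finset.sum_congr rfl fun γ _ => ?_
      rw [Subfield.smul_def, ← hd γ, smul_eq_mul, frobenius_def])
    intro γ
    ext
    rw [← hd γ, this γ]; simp
  have := hli.fintype_card_le_finrank
  rw [Fintype.card_fun, Fintype.card_fin, Fintype.card_fin] at this
  exact (Nat.lt_pow_self hp.out.one_lt).le.trans this

lemma PInd.cons {K : Type*} [Field K] (p : ℕ) [hp : Fact p.Prime] [CharP K p]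
    [hK : Module.Finite (frobenius K p).fieldRange K] {r : ℕ} (t : Fin r → K) (ht : PInd p t)
    (u : K) (hu : ¬ ∃ c : (Fin r → Fin p) → K, u = ∑ γ, c γ ^ p * ∏ i, t i ^ (γ i : ℕ)) :
    PInd p (Fin.cons u t : Fin (r + 1) → K) := by
  let K0 := (frobenius K p).fieldRange
  let L := IntermediateField.adjoin K0 (Set.range t)
  have hK0 : ∀ b : K0, ∃ c : K, algebraMap K0 K b = c ^ p := by
    rintro ⟨_, c, rfl⟩
    exact ⟨c, rfl⟩
  have hL : u ∉ L := by
    intro h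
    have halg : ∀ x ∈ Set.range t, IsAlgebraic K0 x := fun x _ => Algebra.IsAlgebraic.isAlgebraic x
    have h2 : u ∈ L.toSubalgebra := h
    rw [IntermediateField.adjoin_toSubalgebra_of_isAlgebraic halg,
      Algebra.adjoin_range_eq_range_aeval] at h2
    obtain ⟨P, rfl⟩ := h2
    exact hu (exists_reduced p hK0 t P)
  have hpow : ∀ c : K, c ^ p ∈ L := fun c => L.algebraMap_mem (⟨c ^ p, c, rfl⟩ : K0)
  have htL : ∀ i, t i ∈ L := fun i => IntermediateField.subset_adjoin _ _ ⟨i, rfl⟩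
  have hirr : Irreducible (Polynomial.X ^ p - Polynomial.C (⟨u ^ p, hpow u⟩ : L)) := by
    apply X_pow_sub_C_irreducible_of_prime hp.out
    intro b hb
    have : (b : K) ^ p = u ^ p := congrArg Subtype.val hb
    exact hL (frobenius_inj K p this ▸ b.2)
  have hmin : minpoly L u = Polynomial.X ^ p - Polynomial.C (⟨u ^ p, hpow u⟩ : L) := by
    symm
    apply minpoly.eq_of_irreducible_of_monic hirr
    · simp
    · exact Polynomial.monic_X_pow_sub_C _ hp.out.ne_zero
  intro c hc
  rw [← (Fin.consEquiv (fun _ : Fin (r + 1) => Fin p)).sum_comp, Fintype.sum_prod_type] at hc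
  let l : Fin p → L := fun j => ⟨∑ γ, c (Fin.cons j γ) ^ p * ∏ i, t i ^ (γ i : ℕ),
    sum_mem fun γ _ => mul_mem (hpow _) (prod_mem fun i _ => pow_mem (htL i) _)⟩
  let P : Polynomial L := ∑ j : Fin p, Polynomial.C (l j) * Polynomial.X ^ (j : ℕ)
  have hP : Polynomial.aeval u P = 0 := by
    simp only [P, map_sum, map_mul, map_pow, Polynomial.aeval_C, Polynomial.aeval_X]
    rw [← hc]
    refine Finset.sum_congr rfl fun j _ => ?_
    change (∑ γ, c (Fin.cons j γ) ^ p * ∏ i, t i ^ (γ i : ℕ)) * _ = _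
    rw [Finset.sum_mul]
    refine Finset.sum_congr rfl fun γ _ => ?_
    simp [Fin.prod_univ_succ, Fin.consEquiv]
    ring
  have hP0 : P = 0 := by
    by_contra hne
    have h1 := minpoly.degree_le_of_ne_zero L u hne hP
    rw [hmin, Polynomial.degree_X_pow_sub_C hp.out.pos] at h1
    have h2 : P.degree < (p : ℕ) := by
      apply (Polynomial.degree_sum_fin_lt l)
    exact absurd h1 (not_le.mpr h2)
  have hl : ∀ j, l j = 0 := by
    intro j
    have := congrArg (fun Q => Q.coeff j) hP0
    simp only [P, Polynomial.finsetSum_coeff, Polynomial.coeff_C_mul_X_pow, Polynomial.coeff_zero] at this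
    rw [Finset.sum_eq_single j] at this
    · simpa using this
    · intro k _ hk
      rw [if_neg]
      exact fun h => hk (Fin.ext h.symm)
    · simp
  intro γ
  have := ht (fun γ' => c (Fin.cons (γ 0) γ')) (congrArg Subtype.val (hl (γ 0))) (Fin.tail γ)
  simpa using this

lemma exists_pbasis {K : Type*} [Field K] (p : ℕ) [hp : Fact p.Prime] [CharP K p]
    [hK : Module.Finite (frobenius K p).fieldRange K] :
    ∃ (r : ℕ) (t : Fin r → K), PInd p t ∧
      ∀ u, ∃ c : (Fin r → Fin p) → K, u = ∑ γ, c γ ^ p * ∏ i, t i ^ (γ i : ℕ) := by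
  classical
  let Q : ℕ → Prop := fun r => ∃ t : Fin r → K, PInd p t
  have h0 : Q 0 := by
    refine ⟨Fin.elim0, fun c hc γ => ?_⟩
    rw [Fintype.sum_unique] at hc
    simp [hp.out.ne_zero] at hc
    exact (congrArg c (Subsingleton.elim _ _)).trans hc
  have hb : ∀ r, Q r → r ≤ Module.finrank (frobenius K p).fieldRange K := by
    rintro r ⟨t, ht⟩
    exact ht.le
  obtain ⟨t, ht⟩ := Nat.findGreatest_spec (P := Q) (Nat.zero_le
    (Module.finrank (frobenius K p).fieldRange K)) h0
  refine ⟨_, t, ht, ?_⟩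
  intro u
  by_contra hu
  have h1 : Q (_ + 1) := ⟨_, PInd.cons p t ht u hu⟩
  have := Nat.le_findGreatest (hb _ h1) h1
  omega

lemma residue_finite {R : Type*} [CommRing R] [IsLocalRing R] (p : ℕ) [hp : Fact p.Prime] [CharP R p]
    [CharP (IsLocalRing.ResidueField R) p]
    (hF : Module.Finite (↥(frobenius R p).range) R) :
    Module.Finite (frobenius (IsLocalRing.ResidueField R) p).fieldRange
      (IsLocalRing.ResidueField R) := by
  classical
  obtain ⟨s, hs⟩ := hF.fg_top
  refine ⟨⟨s.image (IsLocalRing.residue R), ?_⟩⟩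
  rw [eq_top_iff]
  rintro z -
  obtain ⟨z, rfl⟩ := IsLocalRing.residue_surjective z
  have hz : z ∈ Submodule.span (↥(frobenius R p).range) (s : Set R) := by rw [hs]; trivial
  induction hz using Submodule.span_induction with
  | mem x hx => exact Submodule.subset_span (by simpa using ⟨x, hx, rfl⟩)
  | zero => simp
  | add x y _ _ h1 h2 => rw [map_add]; exact add_mem h1 h2
  | smul a x _ h =>
    obtain ⟨_, c, rfl⟩ := a
    have := Submodule.smul_mem _ (⟨IsLocalRing.residue R c ^ p, _, rfl⟩ :
      (frobenius (IsLocalRing.ResidueField R) p).fieldRange) h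
    rw [Subfield.smul_def] at this
    rw [Subring.smul_def]
    simpa [frobenius_def] using this

/-- lifts of a p-basis of the residue field -/
lemma exists_pbasis_lift {R : Type*} [CommRing R] [IsLocalRing R] (p : ℕ) [hp : Fact p.Prime]
    [CharP R p] (hF : Module.Finite (↥(frobenius R p).range) R) :
    ∃ (r : ℕ) (t : Fin r → R),
      (∀ c : (Fin r → Fin p) → R,
        ∑ γ, c γ ^ p * ∏ i, t i ^ (γ i : ℕ) ∈ IsLocalRing.maximalIdeal R →
        ∀ γ, c γ ∈ IsLocalRing.maximalIdeal R) ∧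
      ∀ u, ∃ c : (Fin r → Fin p) → R,
        u - ∑ γ, c γ ^ p * ∏ i, t i ^ (γ i : ℕ) ∈ IsLocalRing.maximalIdeal R := by
  have : CharP (IsLocalRing.ResidueField R) p := by
    have : ((p : ℕ) : IsLocalRing.ResidueField R) = 0 := by
      rw [← map_natCast (IsLocalRing.residue R), CharP.cast_eq_zero, map_zero]
    exact (CharP.charP_iff_prime_eq_zero hp.out).mpr this
  have := residue_finite p hF
  obtain ⟨r, t, h1, h2⟩ := exists_pbasis (K := IsLocalRing.ResidueField R) p
  choose t' ht' using fun i => IsLocalRing.residue_surjective (t i)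
  have hr : ∀ c : (Fin r → Fin p) → R, IsLocalRing.residue R (∑ γ, c γ ^ p * ∏ i, t' i ^ (γ i : ℕ))
      = ∑ γ, IsLocalRing.residue R (c γ) ^ p * ∏ i, t i ^ (γ i : ℕ) := by
    intro c
    simp [ht']
  refine ⟨r, t', ?_, ?_⟩
  · intro c hc γ
    rw [← IsLocalRing.residue_eq_zero_iff] at hc ⊢
    rw [hr] at hc
    exact h1 _ hc γ
  · intro u
    obtain ⟨c, hc⟩ := h2 (IsLocalRing.residue R u)
    choose c' hc' using fun i => IsLocalRing.residue_surjective (c i)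
    refine ⟨c', ?_⟩
    rw [← IsLocalRing.residue_eq_zero_iff, map_sub, hr, sub_eq_zero, hc]
    simp [hc']

open MvPolynomial in
lemma coeff_pow_mul_monomial {R : Type*} [CommRing R] (p : ℕ) [hp : Fact p.Prime] [CharP R p]
    {d : ℕ} (G : MvPolynomial (Fin d) R) (α α' : Fin d → Fin p) (δ : Fin d →₀ ℕ) :
    coeff (p • δ + Finsupp.equivFunOnFinite.symm (fun i => (α i : ℕ)))
      (G ^ p * monomial (Finsupp.equivFunOnFinite.symm (fun i => (α' i : ℕ))) 1)
      = if α' = α then (coeff δ G) ^ p else 0 := by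
  split_ifs with h
  · subst h
    rw [coeff_mul_monomial, mul_one, ← map_frobenius_expand, coeff_map,
      coeff_expand_smul _ hp.out.ne_zero, frobenius_def]
  · rw [coeff_mul_monomial']
    split_ifs with hle
    · obtain ⟨i, hi⟩ := Function.ne_iff.mp h
      rw [mul_one, ← map_frobenius_expand, coeff_map, coeff_expand_of_not_dvd (i := i), map_zero]
      have h1 := hle i
      simp at h1 ⊢
      have h2 : (α' i : ℕ) ≠ α i := fun h => hi (Fin.ext h)
      have h3 := (α' i).2
      have h4 := (α i).2
      intro ⟨k, hk⟩
      have h5 : p * δ i + α i = p * k + α' i := by omega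
      have h6 := congrArg (· % p) h5
      simp [Nat.mul_add_mod, Nat.mod_eq_of_lt h3, Nat.mod_eq_of_lt h4] at h6
      exact h2 h6.symm
    · rfl

open MvPolynomial in
lemma filt_p_aux {R : Type*} [CommRing R] [IsLocalRing R] (p : ℕ) [hp : Fact p.Prime] [CharP R p]
    {d r : ℕ} (x : Fin d → R) (hx : Ideal.span (Set.range x) = IsLocalRing.maximalIdeal R)
    (hq : QReg x) (t : Fin r → R)
    (ht : ∀ c : (Fin r → Fin p) → R,
        ∑ γ, c γ ^ p * ∏ i, t i ^ (γ i : ℕ) ∈ IsLocalRing.maximalIdeal R →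
        ∀ γ, c γ ∈ IsLocalRing.maximalIdeal R) (N : ℕ)
    (g : (Fin d → Fin p) → (Fin r → Fin p) → R)
    (hg : ∑ α, ∑ β, g α β ^ p * ((∏ i, x i ^ (α i : ℕ)) * ∏ i, t i ^ (β i : ℕ)) ∈
      IsLocalRing.maximalIdeal R ^ N) (α : Fin d → Fin p) (β : Fin r → Fin p) :
    ∃ b, N ≤ p * b + ∑ i, (α i : ℕ) ∧ g α β ∈ IsLocalRing.maximalIdeal R ^ b := by
  classical
  induction N generalizing α β with
  | zero => exact ⟨0, by simp, by simp⟩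
  | succ N ih =>
    set m := IsLocalRing.maximalIdeal R with hm
    choose b hb1 hb2 using ih (Ideal.pow_le_pow_right (Nat.le_succ N) hg)
    have hG : ∀ α β, ∃ G : MvPolynomial (Fin d) R, G.IsHomogeneous (b α β) ∧
        ((p * b α β + ∑ i, (α i : ℕ) = N → eval x G = g α β) ∧
         (p * b α β + ∑ i, (α i : ℕ) ≠ N → G = 0)) := by
      intro α β
      by_cases h : p * b α β + ∑ i, (α i : ℕ) = N
      · obtain ⟨G, h1, h2⟩ := QReg.exists_form x (b α β) (g α β) (by rw [hx]; exact hb2 α β)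
        exact ⟨G, h1, fun _ => h2, fun h' => absurd h h'⟩
      · exact ⟨0, isHomogeneous_zero _ _ _, fun h' => absurd h' h, fun _ => rfl⟩
    choose G hG1 hG2 hG3 using hG
    by_cases hE : p * b α β + ∑ i, (α i : ℕ) = N
    swap
    · exact ⟨b α β, by have := hb1 α β; omega, hb2 α β⟩
    let mon : (Fin d → Fin p) → MvPolynomial (Fin d) R := fun α =>
      monomial (Finsupp.equivFunOnFinite.symm (fun i => (α i : ℕ))) 1
    have hmon : ∀ α, eval x (mon α) = ∏ i, x i ^ (α i : ℕ) := by
      intro α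
      simp only [mon, eval_monomial, one_mul]
      rw [Finsupp.prod_fintype _ _ (by simp)]
      rfl
    let F : MvPolynomial (Fin d) R :=
      ∑ α, ∑ β, C (∏ i, t i ^ (β i : ℕ)) * (G α β ^ p * mon α)
    have hFh : F.IsHomogeneous N := by
      refine IsHomogeneous.sum _ _ _ fun α _ => IsHomogeneous.sum _ _ _ fun β _ => ?_
      by_cases h : p * b α β + ∑ i, (α i : ℕ) = N
      · have h1 : (mon α).IsHomogeneous (∑ i, (α i : ℕ)) := by
          apply isHomogeneous_monomial
          simp [Finsupp.degree_eq_sum]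
        have h2 := (isHomogeneous_C (Fin d) (∏ i, t i ^ (β i : ℕ))).mul (((hG1 α β).pow p).mul h1)
        rw [zero_add, mul_comm (b α β), h] at h2
        exact h2
      · rw [hG3 α β h, zero_pow hp.out.ne_zero, zero_mul, mul_zero]
        exact isHomogeneous_zero _ _ _
    have hFe : eval x F ∈ m ^ (N + 1) := by
      have : ∑ α, ∑ β, g α β ^ p * ((∏ i, x i ^ (α i : ℕ)) * ∏ i, t i ^ (β i : ℕ)) - eval x F
          ∈ m ^ (N + 1) := by
        simp only [F, map_sum, map_mul, eval_C, map_pow, hmon, ← Finset.sum_sub_distrib]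
        refine sum_mem fun α _ => sum_mem fun β _ => ?_
        by_cases h : p * b α β + ∑ i, (α i : ℕ) = N
        · rw [hG2 α β h]
          convert zero_mem (m ^ (N + 1)) using 1
          ring
        · rw [hG3 α β h, map_zero, zero_pow hp.out.ne_zero, zero_mul, mul_zero, sub_zero]
          rw [← mul_assoc]
          apply Ideal.mul_mem_right
          have h1 : g α β ^ p ∈ m ^ (p * b α β) := by
            rw [mul_comm, pow_mul]
            exact Ideal.pow_mem_pow (hb2 α β) p
          have h2 : (∏ i, x i ^ (α i : ℕ)) ∈ m ^ (∑ i, (α i : ℕ)) := by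
            rw [← hmon, ← hx]
            apply QReg.form_mem
            apply isHomogeneous_monomial
            simp [Finsupp.degree_eq_sum]
          have h3 := Ideal.mul_mem_mul h1 h2
          rw [← pow_add] at h3
          exact Ideal.pow_le_pow_right (by have := hb1 α β; omega) h3
      have h2 := sub_mem hg this
      rwa [sub_sub_cancel] at h2
    have hFm := hq N F hFh (by rw [hx]; exact hFe)
    rw [hx, mem_map_C_iff] at hFm
    have hGm : G α β ∈ Ideal.map C m := by
      rw [mem_map_C_iff]
      intro δ
      refine ht (fun β => coeff δ (G α β)) ?_ β
      have h1 := hFm (p • δ + Finsupp.equivFunOnFinite.symm (fun i => (α i : ℕ)))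
      have h2 : coeff (p • δ + Finsupp.equivFunOnFinite.symm (fun i => (α i : ℕ))) F =
          ∑ γ, coeff δ (G α γ) ^ p * ∏ i, t i ^ (γ i : ℕ) := by
        simp only [F, mon, coeff_sum, coeff_C_mul, coeff_pow_mul_monomial]
        rw [Finset.sum_eq_single α]
        · simp [mul_comm]
        · intro α' _ h
          simp [h]
        · simp
      rwa [h2] at h1
    refine ⟨b α β + 1, ?_, ?_⟩
    · have := hp.out.pos
      rw [mul_add]; omega
    · rw [← hG2 α β hE, ← hx]
      apply QReg.form_mem_succ x _ _ (hG1 α β)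
      rwa [hx]

/-- spanning over `q`-th powers -/
def SpanQ {R : Type*} [CommRing R] {σ : Type*} [Fintype σ] [DecidableEq σ] (q : ℕ) (y : σ → R) : Prop :=
  ∀ f : R, ∃ g : (σ → Fin q) → R, f = ∑ γ, g γ ^ q * ∏ i, y i ^ (γ i : ℕ)

/-- compatibility with the adic filtration -/
def FiltQ {R : Type*} [CommRing R] [IsLocalRing R] {σ : Type*} [Fintype σ] [DecidableEq σ] (q : ℕ) (y : σ → R)
    (s : Finset σ) : Prop :=
  ∀ (N : ℕ) (g : (σ → Fin q) → R),
    ∑ γ, g γ ^ q * ∏ i, y i ^ (γ i : ℕ) ∈ IsLocalRing.maximalIdeal R ^ N →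
    ∀ γ, ∃ b, N ≤ q * b + ∑ i ∈ s, (γ i : ℕ) ∧ g γ ∈ IsLocalRing.maximalIdeal R ^ b

lemma filt_p {R : Type*} [CommRing R] [IsLocalRing R] (p : ℕ) [hp : Fact p.Prime] [CharP R p]
    {d r : ℕ} (x : Fin d → R) (hx : Ideal.span (Set.range x) = IsLocalRing.maximalIdeal R)
    (hq : QReg x) (t : Fin r → R)
    (ht : ∀ c : (Fin r → Fin p) → R,
        ∑ γ, c γ ^ p * ∏ i, t i ^ (γ i : ℕ) ∈ IsLocalRing.maximalIdeal R →
        ∀ γ, c γ ∈ IsLocalRing.maximalIdeal R) :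
    FiltQ p (Sum.elim x t) (Finset.univ.map Function.Embedding.inl) := by
  intro N g hg γ
  rw [← (Equiv.sumArrowEquivProdArrow (Fin d) (Fin r) (Fin p)).symm.sum_comp,
    Fintype.sum_prod_type] at hg
  have := filt_p_aux p x hx hq t ht N (fun α β => g (Sum.elim α β)) (by
    simpa [Equiv.sumArrowEquivProdArrow] using hg) (γ ∘ Sum.inl) (γ ∘ Sum.inr)
  simpa using this

lemma span_p {R : Type*} [CommRing R] [IsLocalRing R] [IsNoetherianRing R]
    (p : ℕ) [hp : Fact p.Prime] [CharP R p]
    (hF : Module.Finite (↥(frobenius R p).range) R)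
    {d r : ℕ} (x : Fin d → R) (hx : Ideal.span (Set.range x) = IsLocalRing.maximalIdeal R)
    (t : Fin r → R)
    (ht : ∀ u, ∃ c : (Fin r → Fin p) → R,
        u - ∑ γ, c γ ^ p * ∏ i, t i ^ (γ i : ℕ) ∈ IsLocalRing.maximalIdeal R) :
    SpanQ p (Sum.elim x t) := by
  classical
  set m := IsLocalRing.maximalIdeal R with hm
  let A := (frobenius R p).range
  let M : Subalgebra A R := Algebra.adjoin A (Set.range (Sum.elim x t))
  have hA : ∀ c : R, c ^ p ∈ M := fun c => M.algebraMap_mem (⟨c ^ p, c, rfl⟩ : A)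
  have hxM : ∀ i, x i ∈ M := fun i => Algebra.subset_adjoin ⟨Sum.inl i, rfl⟩
  have htM : ∀ i, t i ∈ M := fun i => Algebra.subset_adjoin ⟨Sum.inr i, rfl⟩
  have h1 : ∀ u, ∃ z ∈ M, u - z ∈ m := by
    intro u
    obtain ⟨c, hc⟩ := ht u
    exact ⟨_, sum_mem fun γ _ => mul_mem (hA _) (prod_mem fun i _ => pow_mem (htM i) _), hc⟩
  have h2 : ∀ N u, ∃ z ∈ M, u - z ∈ m ^ N := by
    intro N
    induction N with
    | zero => exact fun u => ⟨0, zero_mem _, by simp⟩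
    | succ N ih =>
      intro u
      obtain ⟨z, hz, hu⟩ := ih u
      obtain ⟨G, hG, hGe⟩ := QReg.exists_form x N (u - z) (by rw [hx]; exact hu)
      choose w hw hw' using fun δ => h1 (MvPolynomial.coeff δ G)
      refine ⟨z + ∑ δ ∈ G.support, w δ * ∏ i, x i ^ (δ i), add_mem hz (sum_mem fun δ _ =>
        mul_mem (hw δ) (prod_mem fun i _ => pow_mem (hxM i) _)), ?_⟩
      rw [← sub_sub, ← hGe, MvPolynomial.eval_eq', ← Finset.sum_sub_distrib]
      refine sum_mem fun δ hδ => ?_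
      rw [← sub_mul, pow_succ']
      refine Ideal.mul_mem_mul (hw' δ) ?_
      have := QReg.form_mem x N (MvPolynomial.monomial δ 1) (by
        apply MvPolynomial.isHomogeneous_monomial
        rw [Finsupp.degree_eq_weight_one]
        exact hG (MvPolynomial.mem_support_iff.mp hδ))
      rw [hx, MvPolynomial.eval_monomial, one_mul, Finsupp.prod_fintype _ _ (by simp)] at this
      exact this
  let mA : Ideal A := m.comap A.subtype
  have hjac : mA ≤ Ideal.jacobson ⊥ := by
    intro a ha
    rw [Ideal.mem_jacobson_bot]
    intro b
    obtain ⟨a, c, rfl⟩ := a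
    obtain ⟨b, c', rfl⟩ := b
    have hcp : c ^ p ∈ m := ha
    have hc : c ∈ m := (IsLocalRing.maximalIdeal.isMaximal R).isPrime.mem_of_pow_mem p hcp
    have hu : IsUnit (c * c' + 1) := by
      by_contra hnu
      have h3 : c * c' + 1 ∈ m := (IsLocalRing.mem_maximalIdeal _).mpr hnu
      have h4 := (Ideal.add_mem_iff_right m (Ideal.mul_mem_right c' m hc)).mp h3
      exact (IsLocalRing.maximalIdeal.isMaximal R).ne_top ((Ideal.eq_top_iff_one _).mpr h4)
    have := hu.map (frobenius R p).rangeRestrict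
    convert this using 1
    ext
    simp [frobenius_def, add_pow_char, mul_pow]
  obtain ⟨n, hn⟩ : ∃ n, m ^ n ≤ Ideal.span (Set.range fun i => x i ^ p) := by
    apply Ideal.exists_pow_le_of_le_radical_of_fg
    · rw [← hx, Ideal.span_le]
      rintro _ ⟨i, rfl⟩
      exact ⟨p, Ideal.subset_span ⟨i, rfl⟩⟩
    · exact IsNoetherian.noetherian m
  have h3 : ∀ z ∈ Ideal.span (Set.range fun i => x i ^ p), z ∈ mA • (⊤ : Submodule A R) := by
    intro z hz
    rw [Ideal.mem_span_range_iff_exists_fun] at hz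
    obtain ⟨c, rfl⟩ := hz
    refine sum_mem fun i _ => ?_
    have hxi : x i ^ p ∈ m := Ideal.pow_mem_of_mem m
      (by rw [← hx]; exact Ideal.subset_span ⟨i, rfl⟩) p hp.out.pos
    have := Submodule.smul_mem_smul (I := mA) (N := (⊤ : Submodule A R))
      (r := (⟨x i ^ p, x i, rfl⟩ : A)) (n := c i) hxi trivial
    rw [mul_comm]
    exact this
  have htop : (⊤ : Submodule A R) ≤ Subalgebra.toSubmodule M := by
    apply Submodule.le_of_le_smul_of_le_jacobson_bot hF.fg_top hjac
    intro u _
    obtain ⟨z, hz, hu⟩ := h2 n u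
    rw [Submodule.mem_sup]
    exact ⟨z, hz, u - z, h3 _ (hn hu), by ring⟩
  intro f
  have hf : f ∈ M := htop trivial
  simp only [M] at hf
  rw [Algebra.adjoin_range_eq_range_aeval] at hf
  obtain ⟨P, rfl⟩ := hf
  refine exists_reduced p ?_ _ P
  rintro ⟨_, c, rfl⟩
  exact ⟨c, rfl⟩

lemma pow_split_sum {R : Type*} [CommRing R] (p : ℕ) [hp : Fact p.Prime] [CharP R p]
    {σ : Type*} [Fintype σ] [DecidableEq σ] (y : σ → R) (q : ℕ) (h : (σ → Fin (q * p)) → R) :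
    ∑ γ, h γ ^ (q * p) * ∏ i, y i ^ (γ i : ℕ) =
      ∑ γ0 : σ → Fin p, (∑ γ1 : σ → Fin q,
        h (fun i => finProdFinEquiv (γ1 i, γ0 i)) ^ q * ∏ i, y i ^ (γ1 i : ℕ)) ^ p
          * ∏ i, y i ^ (γ0 i : ℕ) := by
  let E : (σ → Fin q) × (σ → Fin p) ≃ (σ → Fin (q * p)) :=
    (Equiv.arrowProdEquivProdArrow _ (fun _ : σ => Fin q) (fun _ => Fin p)).symm.trans
      (Equiv.arrowCongr (Equiv.refl σ) finProdFinEquiv)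
  rw [← E.sum_comp, Fintype.sum_prod_type_right]
  refine Finset.sum_congr rfl fun γ0 _ => ?_
  rw [sum_pow_char, Finset.sum_mul]
  refine Finset.sum_congr rfl fun γ1 _ => ?_
  have hE : ∀ i, E (γ1, γ0) i = finProdFinEquiv (γ1 i, γ0 i) := fun i => rfl
  have hE' : E (γ1, γ0) = fun i => finProdFinEquiv (γ1 i, γ0 i) := rfl
  rw [mul_pow, ← pow_mul, mul_assoc, ← Finset.prod_pow, ← Finset.prod_mul_distrib, hE']
  congr 1
  refine Finset.prod_congr rfl fun i _ => ?_
  rw [← pow_mul, ← pow_add, finProdFinEquiv_apply_val]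
  congr 1
  simp only
  ring

lemma SpanQ.pow {R : Type*} [CommRing R] (p : ℕ) [hp : Fact p.Prime] [CharP R p]
    {σ : Type*} [Fintype σ] [DecidableEq σ] (y : σ → R) (h : SpanQ p y) (e : ℕ) : SpanQ (p ^ e) y := by
  induction e with
  | zero =>
    intro f
    refine ⟨fun _ => f, ?_⟩
    rw [pow_zero, Fintype.sum_unique]
    simp
  | succ e ih =>
    rw [pow_succ]
    intro f
    obtain ⟨g, hg⟩ := h f
    choose k hk using fun γ => ih (g γ)
    refine ⟨fun γ => k (fun i => (finProdFinEquiv.symm (γ i)).2)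
      (fun i => (finProdFinEquiv.symm (γ i)).1), ?_⟩
    rw [pow_split_sum, hg]
    refine Finset.sum_congr rfl fun γ0 _ => ?_
    congr 2
    rw [hk γ0]
    simp only [Equiv.symm_apply_apply]

lemma FiltQ.pow {R : Type*} [CommRing R] [IsLocalRing R] (p : ℕ) [hp : Fact p.Prime] [CharP R p]
    {σ : Type*} [Fintype σ] [DecidableEq σ] (y : σ → R) (s : Finset σ) (h : FiltQ p y s) (e : ℕ) :
    FiltQ (p ^ e) y s := by
  induction e with
  | zero =>
    rw [pow_zero]
    intro N g hg γ
    refine ⟨N, by simp, ?_⟩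
    rw [Fintype.sum_unique] at hg
    rw [Subsingleton.elim γ default]
    simpa using hg
  | succ e ih =>
    rw [pow_succ]
    intro N g hg γ
    rw [pow_split_sum] at hg
    obtain ⟨b', h1, h2⟩ := h N _ hg (fun i => (finProdFinEquiv.symm (γ i)).2)
    obtain ⟨b, h3, h4⟩ := ih b' _ h2 (fun i => (finProdFinEquiv.symm (γ i)).1)
    refine ⟨b, ?_, ?_⟩
    · have hγ : ∀ i, (γ i : ℕ) = ((finProdFinEquiv.symm (γ i)).2 : ℕ)
          + p * ((finProdFinEquiv.symm (γ i)).1 : ℕ) := by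
        intro i
        rw [← finProdFinEquiv_apply_val, Equiv.apply_symm_apply]
      rw [Finset.sum_congr rfl (fun i _ => hγ i), Finset.sum_add_distrib, ← Finset.mul_sum]
      have := Nat.mul_le_mul_left p h3
      rw [mul_add] at this
      calc N ≤ _ := h1
        _ ≤ _ := by nlinarith
    · simp only [Prod.mk.eta, Equiv.apply_symm_apply] at h4
      exact h4

lemma FiltQ.eq_zero {R : Type*} [CommRing R] [IsLocalRing R] [IsNoetherianRing R]
    {σ : Type*} [Fintype σ] [DecidableEq σ] {q : ℕ} {y : σ → R} {s : Finset σ} (h : FiltQ q y s) (hq : 0 < q)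
    (g : (σ → Fin q) → R) (hg : ∑ γ, g γ ^ q * ∏ i, y i ^ (γ i : ℕ) = 0) (γ : σ → Fin q) :
    g γ = 0 := by
  have : g γ ∈ ⨅ i, IsLocalRing.maximalIdeal R ^ i := by
    rw [Submodule.mem_iInf]
    intro n
    obtain ⟨b, h1, h2⟩ := h (q * n + ∑ i ∈ s, (γ i : ℕ)) g (by rw [hg]; exact zero_mem _) γ
    refine Ideal.pow_le_pow_right ?_ h2
    exact Nat.le_of_mul_le_mul_left (Nat.le_of_add_le_add_right h1) hq
  rwa [Ideal.iInf_pow_eq_bot_of_isLocalRing _ (IsLocalRing.maximalIdeal.isMaximal R).ne_top] at this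

lemma IsDiffOp.of_hom {R : Type*} [CommRing R] {S : Type*} [CommRing S] [Algebra R S] (I : Ideal S)
    (φ : R →+ S) (hφ : ∀ r s, φ (r * s) = φ r * φ s) (hI : ∀ r, φ r - algebraMap R S r ∈ I) (n : ℕ) :
    ∀ l : S →ₗ[R] R, (∀ z ∈ I ^ (n + 1), l z = 0) → IsDiffOp R n (l.toAddMonoidHom.comp φ) := by
  induction n with
  | zero =>
    intro l hl r s
    have h1 := hl ((φ r - algebraMap R S r) * φ s) (by
      rw [zero_add, pow_one]; exact Ideal.mul_mem_right _ _ (hI r))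
    rw [sub_mul, map_sub, ← Algebra.smul_def, map_smul, sub_eq_zero, smul_eq_mul, ← hφ] at h1
    exact h1
  | succ n ih =>
    intro l hl r
    convert ih (l.comp (LinearMap.mulLeft R (φ r - algebraMap R S r))) ?_ using 1
    · ext s
      change l (φ (r * s)) - r * l (φ s) = l ((φ r - algebraMap R S r) * φ s)
      rw [sub_mul, map_sub, ← Algebra.smul_def, map_smul, smul_eq_mul, ← hφ]
    · intro z hz
      apply hl
      rw [pow_succ']
      exact Ideal.mul_mem_mul (hI r) hz

open MvPolynomial in
lemma coeff_prod_shift {R : Type*} [CommRing R] {σ : Type*} [Fintype σ] [DecidableEq σ] (y : σ → R)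
    (n : σ → ℕ) (α : σ → ℕ) :
    coeff (Finsupp.equivFunOnFinite.symm α) (∏ i, (C (y i) + X i : MvPolynomial σ R) ^ n i) =
      ∏ i, ((n i).choose (α i) * y i ^ (n i - α i)) := by
  have h1 : ∀ i, (C (y i) + X i : MvPolynomial σ R) ^ n i =
      ∑ k ∈ Finset.range (n i + 1), C ((n i).choose k * y i ^ (n i - k)) * X i ^ k := by
    intro i
    rw [add_comm, add_pow]
    refine Finset.sum_congr rfl fun k _ => ?_
    simp only [map_mul, map_pow, map_natCast]
    ring
  simp_rw [h1]
  rw [Finset.prod_univ_sum, coeff_sum]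
  have h2 : ∀ κ : σ → ℕ, ∏ i, (C ((n i).choose (κ i) * y i ^ (n i - κ i)) * X i ^ κ i : MvPolynomial σ R)
      = monomial (Finsupp.equivFunOnFinite.symm κ)
        (∏ i, (((n i).choose (κ i) : R) * y i ^ (n i - κ i))) := by
    intro κ
    rw [Finset.prod_mul_distrib, ← map_prod, monomial_eq, Finsupp.prod_fintype _ _ (by simp)]
    rfl
  simp_rw [h2, coeff_monomial]
  by_cases hα : α ∈ Fintype.piFinset fun i => Finset.range (n i + 1)
  · rw [Finset.sum_eq_single_of_mem α hα]
    · simp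
    · intro κ _ hκ
      rw [if_neg]
      exact fun h => hκ (Finsupp.equivFunOnFinite.symm.injective h)
  · rw [Finset.sum_eq_zero]
    · symm
      simp only [Fintype.mem_piFinset, Finset.mem_range, not_forall] at hα
      obtain ⟨i, hi⟩ := hα
      apply Finset.prod_eq_zero (Finset.mem_univ i)
      rw [Nat.choose_eq_zero_of_lt (by omega)]
      simp
    · intro κ hκ
      rw [if_neg]
      intro h
      exact hα (Finsupp.equivFunOnFinite.symm.injective h ▸ hκ)

lemma prod_pow_divmod {σ T : Type*} [Fintype σ] [CommRing T] (w : σ → T) (n : σ → ℕ) (q : ℕ) :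
    ∏ i, w i ^ n i = (∏ i, (w i ^ q) ^ (n i / q)) * ∏ i, w i ^ (n i % q) := by
  rw [← Finset.prod_mul_distrib]
  refine Finset.prod_congr rfl fun i _ => ?_
  rw [← pow_mul, ← pow_add, Nat.div_add_mod]

open MvPolynomial in
lemma exists_diffOp {R : Type*} [CommRing R] [IsLocalRing R] [IsNoetherianRing R]
    (p : ℕ) [hp : Fact p.Prime] [CharP R p]
    {σ : Type*} [Fintype σ] [DecidableEq σ] (y : σ → R) (s : Finset σ) (e : ℕ) (hS : SpanQ (p ^ e) y)
    (hFilt : FiltQ (p ^ e) y s) (α : σ → ℕ) (hα0 : α ≠ 0) (hα : ∑ i, α i < p ^ e) :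
    ∃ D : R →+ R, IsDiffOp R (p ^ e - 1) D ∧ D 1 = 0 ∧ ∀ g : (σ → Fin (p ^ e)) → R,
      D (∑ γ, g γ ^ (p ^ e) * ∏ i, y i ^ (γ i : ℕ)) =
        ∑ γ, g γ ^ (p ^ e) * ∏ i, (((γ i : ℕ).choose (α i)) * y i ^ ((γ i : ℕ) - α i)) := by
  have hq0 : 0 < p ^ e := pow_pos hp.out.pos e
  let A := (iterateFrobenius R p e).range
  have hA : ∀ a : A, ∃ c : R, (a : R) = c ^ (p ^ e) := by
    rintro ⟨_, c, rfl⟩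
    exact ⟨c, rfl⟩
  let toA : R → A := fun c => ⟨c ^ (p ^ e), c, rfl⟩
  let v : (σ → Fin (p ^ e)) → R := fun γ => ∏ i, y i ^ (γ i : ℕ)
  have hli : LinearIndependent A v := by
    rw [Fintype.linearIndependent_iff]
    intro c hc
    choose d hd using fun γ => hA (c γ)
    have := hFilt.eq_zero hq0 d (by
      rw [← hc]
      refine Finset.sum_congr rfl fun γ _ => ?_
      rw [Subring.smul_def, hd γ, smul_eq_mul])
    intro γ
    ext
    rw [hd γ, this γ, zero_pow hq0.ne']
    simp
  have hsp : ⊤ ≤ Submodule.span A (Set.range v) := by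
    intro f _
    obtain ⟨g, rfl⟩ := hS f
    refine sum_mem fun γ _ => ?_
    exact Submodule.smul_mem _ (toA (g γ)) (Submodule.subset_span ⟨γ, rfl⟩)
  let B : Module.Basis (σ → Fin (p ^ e)) A R := Module.Basis.mk hli hsp
  have hB : ∀ γ, B γ = ∏ i, y i ^ (γ i : ℕ) := fun γ => by simp [B, v]
  have hX : ∀ i, (X i : MvPolynomial σ R) ∈ idealOfVars σ R :=
    fun i => Ideal.subset_span (Set.mem_range_self i)
  let J : Ideal (MvPolynomial σ R) := idealOfVars σ R ^ (p ^ e)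
  let S := MvPolynomial σ R ⧸ J
  let mk : MvPolynomial σ R →ₐ[R] S := Ideal.Quotient.mkₐ R J
  have hmk : Function.Surjective mk := Ideal.Quotient.mkₐ_surjective R J
  let Y : σ → S := fun i => mk (C (y i) + X i)
  have hYq : ∀ i, Y i ^ (p ^ e) = algebraMap R S (y i ^ (p ^ e)) := by
    intro i
    simp only [Y]
    rw [← map_pow, add_pow_char_pow, map_add, ← map_pow C]
    have h1 : mk (X i ^ p ^ e) = 0 := by
      apply Ideal.Quotient.eq_zero_iff_mem.mpr
      exact Ideal.pow_mem_pow (hX i) _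
    rw [h1, add_zero]
    exact mk.commutes _
  let φ : R →ₗ[A] S := B.constr A (fun γ => ∏ i, Y i ^ (γ i : ℕ))
  have hφB : ∀ γ, φ (B γ) = ∏ i, Y i ^ (γ i : ℕ) := fun γ => B.constr_basis A _ γ
  have hsmul : ∀ (a : A) (z : S), a • z = algebraMap R S (a : R) * z := by
    intro a z
    rw [← Algebra.smul_def]
    rfl
  have hφn : ∀ n : σ → ℕ, φ (∏ i, y i ^ n i) = ∏ i, Y i ^ n i := by
    intro n
    rw [prod_pow_divmod y n (p ^ e), prod_pow_divmod Y n (p ^ e)]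
    have h2 : (∏ i, (y i ^ p ^ e) ^ (n i / p ^ e)) * ∏ i, y i ^ (n i % p ^ e) =
        toA (∏ i, y i ^ (n i / p ^ e)) • B (fun i => ⟨n i % p ^ e, Nat.mod_lt _ hq0⟩) := by
      rw [hB, Subring.smul_def, smul_eq_mul]
      congr 1
      simp only [toA]
      rw [← Finset.prod_pow]
      exact Finset.prod_congr rfl fun i _ => pow_right_comm _ _ _
    rw [h2, map_smul, hφB, hsmul]
    congr 1
    simp only [toA]
    simp_rw [hYq]
    rw [← Finset.prod_pow, map_prod]
    exact Finset.prod_congr rfl fun i _ => by rw [pow_right_comm, map_pow]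
  have hφmul : ∀ r s, φ (r * s) = φ r * φ s := by
    have : (LinearMap.mul A R).compr₂ φ = (LinearMap.mul A S).compl₁₂ φ φ := by
      refine LinearMap.ext_basis B B fun i j => ?_
      simp only [LinearMap.compr₂_apply, LinearMap.mul_apply', LinearMap.compl₁₂_apply]
      rw [hφB, hφB, hB, hB, ← Finset.prod_mul_distrib, ← Finset.prod_mul_distrib]
      simp_rw [← pow_add]
      exact hφn (fun k => (i k : ℕ) + (j k : ℕ))
    intro r s
    exact LinearMap.congr_fun₂ this r s
  let I : Ideal S := Ideal.map mk (idealOfVars σ R)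
  have hI : ∀ r, φ r - algebraMap R S r ∈ I := by
    intro r
    obtain ⟨g, rfl⟩ := hS r
    rw [map_sum, map_sum, ← Finset.sum_sub_distrib]
    refine sum_mem fun γ _ => ?_
    have h1 : g γ ^ p ^ e * ∏ i, y i ^ (γ i : ℕ) = toA (g γ) • B γ := by
      rw [hB]; rfl
    rw [h1, map_smul, hφB, hsmul, Subring.smul_def, smul_eq_mul, map_mul, ← mul_sub, hB]
    apply Ideal.mul_mem_left
    rw [← Ideal.Quotient.eq]
    simp only [map_prod, map_pow]
    refine Finset.prod_congr rfl fun i _ => ?_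
    congr 1
    rw [Ideal.Quotient.eq]
    have : Y i - algebraMap R S (y i) = mk (X i) := by
      simp only [Y]
      rw [map_add]
      have : mk (C (y i)) = algebraMap R S (y i) := mk.commutes _
      rw [this]; ring
    rw [this]
    exact Ideal.mem_map_of_mem _ (hX i)
  have hIq : I ^ (p ^ e) = ⊥ := by
    rw [← Ideal.map_pow]
    exact Ideal.map_quotient_self J
  let α' : σ →₀ ℕ := Finsupp.equivFunOnFinite.symm α
  obtain ⟨l, hl⟩ : ∃ l : S →ₗ[R] R, ∀ P, l (mk P) = coeff α' P := by
    have hker : ∀ P, mk P = 0 → coeff α' P = 0 := by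
      intro P hP
      have h1 : P ∈ J := Ideal.Quotient.eq_zero_iff_mem.mp hP
      rw [mem_pow_idealOfVars_iff'] at h1
      exact h1 α' (by rw [Finsupp.degree_eq_sum]; exact hα)
    have hwd : ∀ P Q, mk P = mk Q → coeff α' P = coeff α' Q := by
      intro P Q h
      have := hker (P - Q) (by rw [map_sub, h, sub_self])
      rwa [coeff_sub, sub_eq_zero] at this
    choose sec hsec using hmk
    refine ⟨{ toFun := fun z => coeff α' (sec z), map_add' := ?_, map_smul' := ?_ }, ?_⟩
    · intro z w
      rw [← coeff_add]
      apply hwd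
      rw [map_add, hsec, hsec, hsec]
    · intro r z
      rw [RingHom.id_apply, ← coeff_smul]
      apply hwd
      rw [map_smul, hsec, hsec]
    · intro P
      exact hwd _ _ (hsec _)
  refine ⟨l.toAddMonoidHom.comp φ.toAddMonoidHom, ?_, ?_, ?_⟩
  · apply IsDiffOp.of_hom I _ hφmul hI
    intro z hz
    rw [Nat.sub_add_cancel hq0, hIq, Ideal.mem_bot] at hz
    rw [hz, map_zero]
  · change l (φ 1) = 0
    have h1 := hφn 0
    simp only [Pi.zero_apply, pow_zero, Finset.prod_const_one] at h1
    rw [h1, ← map_one mk, hl, coeff_one, if_neg]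
    intro h
    apply hα0
    funext i
    have := DFunLike.congr_fun h i
    simpa [α'] using this.symm
  · intro g
    change l (φ _) = _
    rw [map_sum, map_sum]
    refine Finset.sum_congr rfl fun γ _ => ?_
    have h1 : g γ ^ p ^ e * ∏ i, y i ^ (γ i : ℕ) = toA (g γ) • B γ := by
      rw [hB]; rfl
    rw [h1, map_smul, hφB, hsmul, ← Algebra.smul_def, map_smul, smul_eq_mul]
    congr 1
    rw [← coeff_prod_shift, ← hl]
    simp only [Y, map_prod, map_pow]

lemma arith_aux (Q a b G u v : ℕ) (ha : 1 ≤ a) (h1 : Q * (a - 1) + 1 ≤ Q * b + u) (h2 : u + v = G)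
    (h3 : G % Q ≤ v) : Q * a ≤ b * Q + G := by
  have hdm := Nat.div_add_mod G Q
  have h5 : Q * (a - 1) < Q * (b + G / Q) := by
    rw [mul_add]
    generalize Q * (a - 1) = A at *
    generalize Q * b = B at *
    generalize Q * (G / Q) = C at *
    generalize G % Q = E at *
    omega
  have h6 : a ≤ b + G / Q := by
    have := Nat.lt_of_mul_lt_mul_left h5
    omega
  have h7 := Nat.mul_le_mul_left Q h6
  rw [mul_add, mul_comm Q b] at h7
  have := Nat.mul_div_le G Q
  exact h7.trans (Nat.add_le_add_left this _)

lemma backward_aux {R : Type*} [CommRing R] [IsLocalRing R] [IsNoetherianRing R]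
    (p : ℕ) [hp : Fact p.Prime] [CharP R p]
    {σ : Type*} [Fintype σ] [DecidableEq σ] (y : σ → R) (s : Finset σ)
    (hys : ∀ i ∈ s, y i ∈ IsLocalRing.maximalIdeal R) (e : ℕ) (hS : SpanQ (p ^ e) y)
    (hFilt : FiltQ (p ^ e) y s) (a : ℕ) (ha : 1 ≤ a) (g : (σ → Fin (p ^ e)) → R)
    (H : ∀ D : R →+ R, IsDiffOp R (p ^ e - 1) D → D 1 = 0 →
        D (∑ γ, g γ ^ (p ^ e) * ∏ i, y i ^ (γ i : ℕ)) ∈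
          IsLocalRing.maximalIdeal R ^ (p ^ e * (a - 1) + 1))
    (γ : σ → Fin (p ^ e)) (hγ : (fun i => (γ i : ℕ)) ≠ 0) :
    g γ ^ (p ^ e) * ∏ i, y i ^ (γ i : ℕ) ∈ IsLocalRing.maximalIdeal R ^ (p ^ e * a) := by
  have hq0 : 0 < p ^ e := pow_pos hp.out.pos e
  obtain ⟨α, hα0, hα, hαs, hαp⟩ := exists_alpha p e (fun i => (γ i : ℕ)) (fun i => (γ i).2) hγ s
  obtain ⟨D, hD, hD1, hDg⟩ := exists_diffOp p y s e hS hFilt α hα0 hα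
  have hDm := H D hD hD1
  rw [hDg] at hDm
  have hle : ∀ i, α i ≤ (γ i : ℕ) := by
    intro i
    by_contra h
    exact hαp i (by rw [Nat.choose_eq_zero_of_lt (not_le.mp h)]; exact dvd_zero _)
  let h : (σ → Fin (p ^ e)) → R := fun δ =>
    if hδ : ∀ i, (δ i : ℕ) + α i < p ^ e then
      (∏ i, (((δ i : ℕ) + α i).choose (α i) : R)) * g (fun i => ⟨(δ i : ℕ) + α i, hδ i⟩) else 0
  have hsum : ∑ δ, g δ ^ (p ^ e) * ∏ i, ((((δ i : ℕ).choose (α i) : ℕ) : R) * y i ^ ((δ i : ℕ) - α i)) =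
      ∑ δ, h δ ^ (p ^ e) * ∏ i, y i ^ (δ i : ℕ) := by
    classical
    rw [← Finset.sum_filter_of_ne (p := fun δ : σ → Fin (p ^ e) => ∀ i, α i ≤ (δ i : ℕ)),
      ← Finset.sum_filter_of_ne (s := Finset.univ) (f := fun δ => h δ ^ (p ^ e) * ∏ i, y i ^ (δ i : ℕ))
        (p := fun δ : σ → Fin (p ^ e) => ∀ i, (δ i : ℕ) + α i < p ^ e)]
    · refine Finset.sum_bij' (fun δ _ => fun i => ⟨(δ i : ℕ) - α i, (Nat.sub_le _ _).trans_lt (δ i).2⟩)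
        (fun δ hδ => fun i => ⟨(δ i : ℕ) + α i, (Finset.mem_filter.mp hδ).2 i⟩) ?_ ?_ ?_ ?_ ?_
      · intro δ hδ
        have hδ := (Finset.mem_filter.mp hδ).2
        refine Finset.mem_filter.mpr ⟨Finset.mem_univ _, fun i => ?_⟩
        have := (δ i).2
        have := hδ i
        simp only
        omega
      · intro δ hδ
        refine Finset.mem_filter.mpr ⟨Finset.mem_univ _, fun i => ?_⟩
        simp
      · intro δ hδ
        have hδ := (Finset.mem_filter.mp hδ).2
        funext i
        ext
        exact Nat.sub_add_cancel (hδ i)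
      · intro δ hδ
        funext i
        ext
        simp
      · intro δ hδ
        have hδ := (Finset.mem_filter.mp hδ).2
        have h1 : ∀ i, (δ i : ℕ) - α i + α i = δ i := fun i => Nat.sub_add_cancel (hδ i)
        have h2 : h (fun i => ⟨(δ i : ℕ) - α i, (Nat.sub_le _ _).trans_lt (δ i).2⟩) =
            (∏ i, ((δ i : ℕ).choose (α i) : R)) * g δ := by
          simp only [h]
          rw [dif_pos (fun i => by rw [h1]; exact (δ i).2)]
          simp only [h1]
        rw [h2, mul_pow, Finset.prod_mul_distrib]
        have h3 : (∏ i, ((δ i : ℕ).choose (α i) : R)) ^ (p ^ e) = ∏ i, ((δ i : ℕ).choose (α i) : R) := by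
          rw [← Nat.cast_prod]
          have := map_natCast (iterateFrobenius R p e) (∏ i, (δ i : ℕ).choose (α i))
          rwa [iterateFrobenius_def] at this
        rw [h3]
        ring
    · intro δ _ hne
      by_contra hcon
      apply hne
      simp only [h]
      rw [dif_neg hcon, zero_pow hq0.ne', zero_mul]
    · intro δ _ hne i
      by_contra hcon
      apply hne
      rw [Finset.prod_eq_zero (Finset.mem_univ i), mul_zero]
      rw [Nat.choose_eq_zero_of_lt (not_le.mp hcon), Nat.cast_zero, zero_mul]
  rw [hsum] at hDm
  obtain ⟨b, hb1, hb2⟩ := hFilt _ h hDm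
    (fun i => ⟨(γ i : ℕ) - α i, (Nat.sub_le _ _).trans_lt (γ i).2⟩)
  have h1 : ∀ i, (γ i : ℕ) - α i + α i = γ i := fun i => Nat.sub_add_cancel (hle i)
  have h2 : h (fun i => ⟨(γ i : ℕ) - α i, (Nat.sub_le _ _).trans_lt (γ i).2⟩) =
      (∏ i, ((γ i : ℕ).choose (α i) : R)) * g γ := by
    simp only [h]
    rw [dif_pos (fun i => by rw [h1]; exact (γ i).2)]
    simp only [h1]
  have hunit : IsUnit (∏ i, ((γ i : ℕ).choose (α i) : R)) := by
    rw [← Nat.cast_prod]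
    rw [CharP.isUnit_natCast_iff (p := p) hp.out]
    intro hdvd
    obtain ⟨i, _, hi⟩ := (Prime.dvd_finset_prod_iff hp.out.prime _).mp hdvd
    exact hαp i hi
  rw [h2, Ideal.unit_mul_mem_iff_mem _ hunit] at hb2
  have hsub : ∑ i ∈ s, ((γ i : ℕ) - α i) + ∑ i ∈ s, α i = ∑ i ∈ s, (γ i : ℕ) := by
    rw [← Finset.sum_add_distrib]
    exact Finset.sum_congr rfl fun i _ => h1 i
  simp only at hb1 hαs
  have hN : p ^ e * a ≤ b * p ^ e + ∑ i ∈ s, (γ i : ℕ) := by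
    exact arith_aux _ _ _ _ _ _ ha hb1 hsub hαs
  refine Ideal.pow_le_pow_right hN ?_
  rw [pow_add]
  refine Ideal.mul_mem_mul ?_ ?_
  · rw [pow_mul]
    exact Ideal.pow_mem_pow hb2 _
  · rw [← Finset.prod_mul_prod_compl s]
    refine Ideal.mul_mem_right _ _ ?_
    rw [← Finset.prod_pow_eq_pow_sum]
    exact Ideal.prod_mem_prod fun i hi => Ideal.pow_mem_pow (hys i hi) _

/-- In an `F`-finite regular local ring `(R, m)` of characteristic `p > 0`, `q = p ^ e`,
and `a ≥ 1`: `f ∈ R ^ q + m ^ (q a)` iff `D f ∈ m ^ (q (a - 1) + 1)` for every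
differential operator `D` of order at most `q - 1` with `D 1 = 0`. -/
theorem mem_powQ_add_pow_maximalIdeal_iff_diffOp
    (R : Type*) [CommRing R] [IsDomain R] [IsLocalRing R] (hreg : IsRegularLocal R)
    (p : ℕ) [Fact p.Prime] [CharP R p]
    (hF : Module.Finite (↥(frobenius R p).range) R)
    (e q : ℕ) (hq : q = p ^ e) (a : ℕ) (ha : 1 ≤ a) (f : R) :
    (∃ lam : R, f - lam ^ q ∈ IsLocalRing.maximalIdeal R ^ (q * a)) ↔
      ∀ D : R →+ R, IsDiffOp R (q - 1) D → D 1 = 0 →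
        D f ∈ IsLocalRing.maximalIdeal R ^ (q * (a - 1) + 1) := by
  subst hq
  have hp : p.Prime := Fact.out
  have hq0 : 0 < p ^ e := pow_pos hp.pos e
  constructor
  · rintro ⟨lam, hlam⟩ D hD hD1
    have h1 := IsDiffOp.map_pow_mem _ _ D hD _ _ hlam
    rw [map_sub, IsDiffOp.map_pow_q p e D hD hD1 lam, sub_zero] at h1
    convert h1 using 2
    obtain ⟨a, rfl⟩ := Nat.exists_eq_add_of_le' ha
    rw [Nat.add_sub_cancel, mul_add, mul_one]
    omega
  · intro H
    obtain ⟨hN, rs, hrs, hspan⟩ := hreg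
    obtain ⟨n, x, hx, hqx⟩ := QReg.of_list rs hrs.toIsWeaklyRegular
    have hx : Ideal.span (Set.range x) = IsLocalRing.maximalIdeal R := hx.trans hspan
    obtain ⟨r, t, ht1, ht2⟩ := exists_pbasis_lift p hF
    have hFilt := (filt_p p x hx hqx t ht1).pow p _ _ e
    have hS := (span_p p hF x hx t ht2).pow p _ e
    obtain ⟨g, hg⟩ := hS f
    rw [hg] at H
    let z : Fin n ⊕ Fin r → Fin (p ^ e) := fun _ => ⟨0, hq0⟩
    refine ⟨g z, ?_⟩
    rw [hg, ← Finset.add_sum_erase _ _ (Finset.mem_univ z)]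
    have hz : g z ^ p ^ e * ∏ i, Sum.elim x t i ^ (z i : ℕ) = g z ^ p ^ e := by simp [z]
    rw [hz, add_sub_cancel_left]
    refine sum_mem fun γ hγ => ?_
    refine backward_aux p (Sum.elim x t) _ ?_ e hS hFilt a ha g H γ ?_
    · intro i hi
      obtain ⟨i, _, rfl⟩ := Finset.mem_map.mp hi
      rw [← hx]
      exact Ideal.subset_span ⟨i, rfl⟩
    · intro h
      apply Finset.ne_of_mem_erase hγ
      funext i
      ext
      exact congrFun h i
end

section
/- Let (R, m) be an F-finite regular local ring of characteristic p > 0, q = p^e, and let x ∈ R be a nonzero element with R/xR regular. Let f ∈ R ∖ R^q, let n be the largest integer with D(f) ∈ x^n R for all differential operators D of order ≤ q − 1 with D(1) = 0, and let a be the largest integer with f ∈ R^q + x^{qa} R. Then n = qa; in particular q divides n. -/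
section AdPart

/-- commutator with multiplication by `r` -/
def adOp {R : Type*} [CommRing R] (r : R) (D : R →+ R) : R →+ R :=
  (D.comp (AddMonoidHom.mulLeft r)) - ((AddMonoidHom.mulLeft r).comp D)

theorem adOp_apply {R : Type*} [CommRing R] (r : R) (D : R →+ R) (s : R) :
    adOp r D s = D (r * s) - r * D s := rfl

theorem isDiffOp_succ_iff {R : Type*} [CommRing R] (n : ℕ) (D : R →+ R) :
    IsDiffOp R (n + 1) D ↔ ∀ r, IsDiffOp R n (adOp r D) := Iff.rfl

theorem isDiffOp_zero_iff {R : Type*} [CommRing R] (D : R →+ R) :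
    IsDiffOp R 0 D ↔ ∀ r, adOp r D = 0 := by
  constructor
  · intro h r
    ext s
    rw [adOp_apply, h r s]; simp
  · intro h r s
    have := DFunLike.congr_fun (h r) s
    rw [adOp_apply] at this
    exact sub_eq_zero.mp (by simpa using this)

theorem adOp_iterate_eq_zero {R : Type*} [CommRing R] (n : ℕ) (D : R →+ R)
    (h : IsDiffOp R n D) (r : R) : (adOp r)^[n + 1] D = 0 := by
  induction n generalizing D with
  | zero => simpa using (isDiffOp_zero_iff D).mp h r
  | succ n ih =>
    rw [Function.iterate_succ_apply]
    exact ih _ ((isDiffOp_succ_iff n D).mp h r)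

theorem adOp_iterate_pow {R : Type*} [CommRing R] (p : ℕ) [hp : Fact p.Prime] [CharP R p]
    (e : ℕ) (c : R) (D : R →+ R) : (adOp c)^[p ^ e] D = adOp (c ^ p ^ e) D := by
  let lam : R → (AddMonoid.End (R →+ R)) := fun c => AddMonoidHom.compHom (AddMonoidHom.mulLeft c)
  let rho : R → (AddMonoid.End (R →+ R)) := fun c => AddMonoidHom.compHom' (AddMonoidHom.mulLeft c)
  have hnt : Nontrivial R := CharP.nontrivial_of_char_ne_one hp.out.ne_one (R := R)
  have hlr : ∀ c d, Commute (rho c) (lam d) := by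
    intro c d
    refine AddMonoidHom.ext fun D => ?_
    rfl
  have hlp : ∀ (c : R) n, lam c ^ n = lam (c ^ n) := by
    intro c n
    induction n with
    | zero =>
      rw [pow_zero]
      refine AddMonoidHom.ext fun D => AddMonoidHom.ext fun s => ?_
      change D s = c ^ 0 * D s
      simp
    | succ n ih =>
      rw [pow_succ, ih]
      refine AddMonoidHom.ext fun D => AddMonoidHom.ext fun s => ?_
      change c ^ n * (c * D s) = c ^ (n + 1) * D s
      ring
  have hrp : ∀ (c : R) n, rho c ^ n = rho (c ^ n) := by
    intro c n
    induction n with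
    | zero =>
      rw [pow_zero]
      refine AddMonoidHom.ext fun D => AddMonoidHom.ext fun s => ?_
      change D s = D (c ^ 0 * s)
      simp
    | succ n ih =>
      rw [pow_succ, ih]
      refine AddMonoidHom.ext fun D => AddMonoidHom.ext fun s => ?_
      change D (c * (c ^ n * s)) = D (c ^ (n + 1) * s)
      ring_nf
  have had : ∀ c D, adOp c D = (rho c - lam c) D := by
    intro c D; rfl
  have hit : ∀ n, (adOp c)^[n] D = ((rho c - lam c) ^ n) D := by
    intro n
    induction n with
    | zero => rfl
    | succ n ih => rw [Function.iterate_succ_apply', ih, had, pow_succ']; rfl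
  have hpT : (p : (AddMonoid.End (R →+ R))) = 0 := by
    refine AddMonoidHom.ext fun D => AddMonoidHom.ext fun s => ?_
    have h : ((p : AddMonoid.End (R →+ R)) D) = p • D := AddMonoid.End.natCast_apply p D
    have h2 : (p • D) s = (p : R) * D s := by simp
    exact (DFunLike.congr_fun h s).trans (h2.trans (by rw [CharP.cast_eq_zero, zero_mul]; rfl))
  have hTn : Nontrivial (AddMonoid.End (R →+ R)) := by
    refine ⟨⟨1, 0, fun h => ?_⟩⟩
    have h1 : (1 : R) = 0 := DFunLike.congr_fun (DFunLike.congr_fun h (AddMonoidHom.id R)) 1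
    exact one_ne_zero h1
  have hT : CharP (AddMonoid.End (R →+ R)) p := by
    obtain ⟨r, hr⟩ := CharP.exists (AddMonoid.End (R →+ R))
    have h1 : r ∣ p := (CharP.cast_eq_zero_iff (AddMonoid.End (R →+ R)) r p).mp hpT
    rcases (Nat.dvd_prime hp.out).mp h1 with h | h
    · exact absurd h (CharP.char_ne_one (AddMonoid.End (R →+ R)) r)
    · exact h ▸ hr
  rw [hit, sub_pow_char_pow_of_commute _ _ (hlr c c), hlp, hrp, had]

theorem IsDiffOp.map_pow_mul {R : Type*} [CommRing R] (p : ℕ) [hp : Fact p.Prime] [CharP R p]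
    (e : ℕ) (D : R →+ R) (h : IsDiffOp R (p ^ e - 1) D) (c s : R) :
    D (c ^ p ^ e * s) = c ^ p ^ e * D s := by
  have h1 := adOp_iterate_eq_zero _ D h c
  rw [Nat.sub_add_cancel (Nat.pos_of_ne_zero (pow_ne_zero e hp.out.ne_zero)),
    adOp_iterate_pow] at h1
  have := DFunLike.congr_fun h1 s
  rw [adOp_apply] at this
  exact sub_eq_zero.mp (by simpa using this)

theorem adOp_comm {R : Type*} [CommRing R] (r s : R) (D : R →+ R) :
    adOp r (adOp s D) = adOp s (adOp r D) := by
  ext t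
  simp only [adOp_apply]
  rw [mul_left_comm s r t]
  ring

theorem adOp_zero {R : Type*} [CommRing R] (r : R) : adOp r (0 : R →+ R) = 0 := by
  ext t; simp [adOp_apply]

theorem adOp_iter_zero {R : Type*} [CommRing R] (r : R) (n : ℕ) :
    (adOp r)^[n] (0 : R →+ R) = 0 := by
  induction n with
  | zero => rfl
  | succ n ih => rw [Function.iterate_succ_apply, adOp_zero, ih]

theorem adOp_iter_add {R : Type*} [CommRing R] (r : R) (n : ℕ) (D E : R →+ R) :
    (adOp r)^[n] (D + E) = (adOp r)^[n] D + (adOp r)^[n] E := by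
  induction n generalizing D E with
  | zero => rfl
  | succ n ih =>
    have : adOp r (D + E) = adOp r D + adOp r E := by
      ext t; simp only [adOp_apply, AddMonoidHom.add_apply]; ring
    rw [Function.iterate_succ_apply, this, ih]; rfl

theorem adOp_iter_compRight {R : Type*} [CommRing R] (r s : R) (n : ℕ) (D : R →+ R) :
    (adOp r)^[n] (D.comp (AddMonoidHom.mulLeft s)) =
      ((adOp r)^[n] D).comp (AddMonoidHom.mulLeft s) := by
  induction n generalizing D with
  | zero => rfl
  | succ n ih =>
    have : adOp r (D.comp (AddMonoidHom.mulLeft s)) =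
        (adOp r D).comp (AddMonoidHom.mulLeft s) := by
      ext t
      simp only [adOp_apply, AddMonoidHom.comp_apply, AddMonoidHom.coe_mulLeft]
      rw [mul_left_comm]
    rw [Function.iterate_succ_apply, this, ih]; rfl

theorem adOp_iter_compLeft {R : Type*} [CommRing R] (r s : R) (n : ℕ) (D : R →+ R) :
    (adOp r)^[n] ((AddMonoidHom.mulLeft s).comp D) =
      (AddMonoidHom.mulLeft s).comp ((adOp r)^[n] D) := by
  induction n generalizing D with
  | zero => rfl
  | succ n ih =>
    have : adOp r ((AddMonoidHom.mulLeft s).comp D) =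
        (AddMonoidHom.mulLeft s).comp (adOp r D) := by
      ext t
      simp only [adOp_apply, AddMonoidHom.comp_apply, AddMonoidHom.coe_mulLeft]
      ring
    rw [Function.iterate_succ_apply, this, ih]; rfl

theorem adOp_neg_left {R : Type*} [CommRing R] (r : R) (D : R →+ R) :
    adOp (-r) D = (AddMonoidHom.mulLeft (-1)).comp (adOp r D) := by
  ext t
  simp only [adOp_apply, AddMonoidHom.comp_apply, AddMonoidHom.coe_mulLeft, neg_mul, map_neg]
  ring

theorem adOp_gen {R : Type*} [CommRing R] (G : Set R) (z : R)
    (hG : Subring.closure (insert z G) = ⊤) (n : ℕ) (D : R →+ R)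
    (hD : ∀ g ∈ G, adOp g D = 0) (hz : (adOp z)^[n + 1] D = 0) (r : R) :
    (adOp z)^[n] (adOp r D) = 0 := by
  have hr : r ∈ Subring.closure (insert z G) := hG ▸ Subring.mem_top r
  induction hr using Subring.closure_induction with
  | mem y hy =>
    rcases hy with rfl | hy
    · simpa [Function.iterate_succ_apply] using hz
    · rw [hD y hy, adOp_iter_zero]
  | zero =>
    have : adOp 0 D = 0 := by ext t; simp [adOp_apply]
    rw [this, adOp_iter_zero]
  | one =>
    have : adOp 1 D = 0 := by ext t; simp [adOp_apply]
    rw [this, adOp_iter_zero]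
  | add a b _ _ iha ihb =>
    have : adOp (a + b) D = adOp a D + adOp b D := by
      ext t; simp only [adOp_apply, AddMonoidHom.add_apply, add_mul, map_add]; ring
    rw [this, adOp_iter_add, iha, ihb, add_zero]
  | neg a _ iha => rw [adOp_neg_left, adOp_iter_compLeft, iha]; ext; simp
  | mul a b _ _ iha ihb =>
    have : adOp (a * b) D = (adOp a D).comp (AddMonoidHom.mulLeft b) +
        (AddMonoidHom.mulLeft a).comp (adOp b D) := by
      ext t
      simp only [adOp_apply, AddMonoidHom.add_apply, AddMonoidHom.comp_apply,
        AddMonoidHom.coe_mulLeft, mul_assoc]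
      ring
    rw [this, adOp_iter_add, adOp_iter_compRight, adOp_iter_compLeft, iha, ihb]
    ext; simp

theorem isDiffOp_of_gen {R : Type*} [CommRing R] (G : Set R) (z : R)
    (hG : Subring.closure (insert z G) = ⊤) (n : ℕ) (D : R →+ R)
    (hD : ∀ g ∈ G, adOp g D = 0) (hz : (adOp z)^[n + 1] D = 0) : IsDiffOp R n D := by
  induction n generalizing D with
  | zero =>
    rw [isDiffOp_zero_iff]
    intro r
    exact adOp_gen G z hG 0 D hD hz r
  | succ n ih =>
    rw [isDiffOp_succ_iff]
    intro r
    refine ih _ (fun g hg => ?_) (adOp_gen G z hG (n + 1) D hD hz r)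
    rw [adOp_comm, hD g hg, adOp_zero]

end AdPart

section BasisPart

/-- monomials -/
def monom {R ι : Type*} [CommRing R] [Fintype ι] (z : ι → R) (g : ι → ℕ) : R := ∏ i, z i ^ g i

/-- expansion with `q`-th power coefficients -/
def expF {R ι : Type*} [CommRing R] [Fintype ι] [DecidableEq ι] (q : ℕ) (z : ι → R)
    (c : (ι → Fin q) → R) : R :=
  ∑ b : ι → Fin q, c b ^ q * monom z (fun i => (b i : ℕ))

variable {R ι : Type*} [CommRing R] [Fintype ι]

theorem monom_add (z : ι → R) (g h : ι → ℕ) : monom z (g + h) = monom z g * monom z h := by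
  simp [monom, pow_add, Finset.prod_mul_distrib]

theorem monom_zero (z : ι → R) : monom z 0 = 1 := by simp [monom]

theorem monom_single [DecidableEq ι] (z : ι → R) (j : ι) : monom z (Pi.single j 1) = z j := by
  unfold monom
  rw [Finset.prod_eq_single j]
  · simp
  · intro b _ hb; simp [hb]
  · simp

variable [DecidableEq ι]

theorem expF_mul (q : ℕ) (z : ι → R) (a : R) (c : (ι → Fin q) → R) :
    expF q z (fun b => a * c b) = a ^ q * expF q z c := by
  simp [expF, Finset.mul_sum, mul_pow, mul_assoc]

theorem expF_single (q : ℕ) (hq : q ≠ 0) (z : ι → R) (b : ι → Fin q) (a : R) :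
    expF q z (Pi.single b a) = a ^ q * monom z (fun i => (b i : ℕ)) := by
  unfold expF
  rw [Finset.sum_eq_single b]
  · simp
  · intro b' _ hb; simp [hb, hq]
  · simp

theorem expF_add (p : ℕ) [hp : Fact p.Prime] [CharP R p] (e : ℕ) (z : ι → R)
    (c d : (ι → Fin (p ^ e)) → R) :
    expF (p ^ e) z (c + d) = expF (p ^ e) z c + expF (p ^ e) z d := by
  simp [expF, add_pow_char_pow, add_mul, Finset.sum_add_distrib]

/-- residues of exponents -/
def modq (q : ℕ) [NeZero q] (g : ι → ℕ) : ι → Fin q := fun i => Fin.ofNat q (g i)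

theorem monom_eq_expF (q : ℕ) [NeZero q] (z : ι → R) (g : ι → ℕ) :
    monom z g = expF q z (Pi.single (modq q g) (monom z (fun i => g i / q))) := by
  rw [expF_single q (NeZero.ne q)]
  unfold monom
  rw [← Finset.prod_pow, ← Finset.prod_mul_distrib]
  refine Finset.prod_congr rfl fun i _ => ?_
  rw [← pow_mul, ← pow_add]
  congr 1
  simp only [modq, Fin.val_ofNat]
  rw [mul_comm, Nat.div_add_mod]

/-- The additive version of `expF`. -/
def expFHom (p : ℕ) [hp : Fact p.Prime] [CharP R p] (e : ℕ) (z : ι → R) :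
    ((ι → Fin (p ^ e)) → R) →+ R :=
  AddMonoidHom.mk' (expF (p ^ e) z) (expF_add p e z)

/-- coefficient shift -/
def shiftC (q : ℕ) [NeZero q] (i : ι) (k : Fin q) : ((ι → Fin q) → R) →+ ((ι → Fin q) → R) :=
  AddMonoidHom.mk' (fun c b => if b i = 0 then c (Function.update b i k) else 0) (by
    intro c d
    ext b
    by_cases h : b i = 0 <;> simp [h])

theorem shiftC_apply (q : ℕ) [NeZero q] (i : ι) (k : Fin q) (c : (ι → Fin q) → R)
    (b : ι → Fin q) :
    shiftC q i k c b = if b i = 0 then c (Function.update b i k) else 0 := rfl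

theorem shiftC_single (q : ℕ) [NeZero q] (i : ι) (k : Fin q) (b : ι → Fin q) (a : R) :
    shiftC q i k (Pi.single b a) =
      if b i = k then Pi.single (Function.update b i 0) a else 0 := by
  ext b'
  rw [shiftC_apply]
  by_cases h1 : b' i = 0
  · rw [if_pos h1]
    by_cases h2 : b i = k
    · rw [if_pos h2]
      by_cases h3 : Function.update b' i k = b
      · subst h3
        have : Function.update (Function.update b' i k) i 0 = b' := by
          rw [Function.update_idem, ← h1, Function.update_eq_self]
        rw [this]; simp
      · rw [Pi.single_eq_of_ne h3, Pi.single_eq_of_ne]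
        rintro rfl
        apply h3
        rw [Function.update_idem, ← h2, Function.update_eq_self]
    · rw [if_neg h2, Pi.single_eq_of_ne]
      · rfl
      · rintro rfl
        simp at h2
  · rw [if_neg h1]
    by_cases h2 : b i = k
    · rw [if_pos h2, Pi.single_eq_of_ne]
      rintro rfl
      simp at h1
    · rw [if_neg h2]; rfl

theorem exists_diffOp_s14 (p : ℕ) [hp : Fact p.Prime] [CharP R p] (e : ℕ) (z : ι → R)
    (hz : Function.Bijective (expF (p ^ e) z)) [NeZero (p ^ e)] (i : ι) (k : Fin (p ^ e)) :
    ∃ D : R →+ R, IsDiffOp R (p ^ e - 1) D ∧ (k ≠ 0 → D 1 = 0) ∧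
      ∀ c, D (expF (p ^ e) z c) = expF (p ^ e) z (shiftC (p ^ e) i k c) := by
  let E := AddEquiv.ofBijective (expFHom p e z) hz
  let D : R →+ R := ((expFHom p e z).comp (shiftC (p ^ e) i k)).comp E.symm.toAddMonoidHom
  have hD : ∀ c, D (expF (p ^ e) z c) = expF (p ^ e) z (shiftC (p ^ e) i k c) := by
    intro c
    have : E.symm (expF (p ^ e) z c) = c := E.symm_apply_apply c
    change expF (p ^ e) z (shiftC (p ^ e) i k (E.symm (expF (p ^ e) z c))) = _
    rw [this]
  have hpow : ∀ a s, D (a ^ p ^ e * s) = a ^ p ^ e * D s := by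
    intro a s
    obtain ⟨c, rfl⟩ := hz.2 s
    rw [← expF_mul, hD, hD, ← expF_mul]
    congr 1
    ext b
    simp only [shiftC_apply]
    split_ifs <;> simp
  have hmon : ∀ g : ι → ℕ, D (monom z g) = if Fin.ofNat (p ^ e) (g i) = k then
      monom z (Function.update g i (p ^ e * (g i / p ^ e))) else 0 := by
    intro g
    rw [monom_eq_expF (p ^ e) z g, hD, shiftC_single]
    change expF (p ^ e) z (if Fin.ofNat (p ^ e) (g i) = k then _ else _) = _
    split_ifs with h
    · rw [expF_single _ (NeZero.ne _)]
      unfold monom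
      rw [← Finset.prod_pow, ← Finset.prod_mul_distrib]
      refine Finset.prod_congr rfl fun j _ => ?_
      rw [← pow_mul, ← pow_add]
      congr 1
      by_cases hj : j = i
      · subst hj
        simp [mul_comm]
      · simp only [modq, Function.update_of_ne hj, Fin.val_ofNat]
        rw [mul_comm, Nat.div_add_mod]
    · exact (expFHom p e z).map_zero
  refine ⟨D, ?_, ?_, hD⟩
  · refine isDiffOp_of_gen (Set.range (fun c : R => c ^ p ^ e) ∪ {y | ∃ j, j ≠ i ∧ y = z j})
      (z i) ?_ _ D ?_ ?_
    · rw [eq_top_iff]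
      rintro r -
      obtain ⟨c, rfl⟩ := hz.2 r
      unfold expF monom
      refine Subring.sum_mem _ fun b _ => Subring.mul_mem _ ?_ (Subring.prod_mem _ fun j _ =>
        Subring.pow_mem _ ?_ _)
      · exact Subring.subset_closure (Or.inr (Or.inl ⟨_, rfl⟩))
      · by_cases hj : j = i
        · subst hj; exact Subring.subset_closure (Or.inl rfl)
        · exact Subring.subset_closure (Or.inr (Or.inr ⟨j, hj, rfl⟩))
    · rintro g (⟨c, rfl⟩ | ⟨j, hj, rfl⟩)
      · ext s
        rw [adOp_apply, hpow]; simp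
      · ext s
        rw [adOp_apply]
        obtain ⟨c, rfl⟩ := hz.2 s
        rw [AddMonoidHom.zero_apply, sub_eq_zero]
        unfold expF
        rw [Finset.mul_sum, map_sum, map_sum, Finset.mul_sum]
        refine Finset.sum_congr rfl fun b _ => ?_
        rw [mul_left_comm, hpow, hpow, mul_left_comm]
        congr 1
        conv_lhs => rw [← monom_single z j, ← monom_add]
        rw [hmon, hmon]
        have h0 : ((Pi.single j 1 : ι → ℕ) + fun i => (b i : ℕ)) i = b i := by
          simp [Ne.symm hj]
        rw [h0]
        split_ifs
        · conv_rhs => rw [← monom_single z j, ← monom_add]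
          congr 1
          ext l
          by_cases hl : l = i
          · subst hl; simp [Ne.symm hj]
          · simp [Function.update_of_ne hl]
        · simp
    · rw [Nat.sub_add_cancel (Nat.pos_of_ne_zero (NeZero.ne _)), adOp_iterate_pow]
      ext s
      rw [adOp_apply, hpow]; simp
  · intro hk
    rw [← monom_zero z, hmon, if_neg]
    intro h
    apply hk
    rw [← h]
    simp

end BasisPart

section StepPart

variable {R ι : Type*} [CommRing R] [Fintype ι] [DecidableEq ι]

/-- extend an exponent by a first coordinate -/
def consO {α ι : Type*} (j : α) (b : ι → α) : Option ι → α := fun o => o.elim j b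

theorem expF_option (q : ℕ) (x : R) (z : ι → R) (c : (Option ι → Fin q) → R) :
    expF q (consO x z) c = ∑ j : Fin q, x ^ (j : ℕ) * expF q z (fun b => c (consO j b)) := by
  unfold expF
  rw [← (Equiv.piOptionEquivProd (β := fun _ : Option ι => Fin q)).symm.sum_comp,
    Fintype.sum_prod_type]
  refine Finset.sum_congr rfl fun j _ => ?_
  rw [Finset.mul_sum]
  refine Finset.sum_congr rfl fun b _ => ?_
  have h1 : (Equiv.piOptionEquivProd (β := fun _ : Option ι => Fin q)).symm (j, b) =
      consO j b := by
    ext o; cases o <;> rfl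
  rw [h1]
  unfold monom
  rw [Fintype.prod_option]
  change _ * (x ^ (j : ℕ) * ∏ i, z i ^ (b i : ℕ)) = _
  ring

theorem consO_eta {α : Type*} (b : Option ι → α) : consO (b none) (fun i => b (some i)) = b := by
  ext o; cases o <;> rfl

theorem expF_map {S : Type*} [CommRing S] (f : R →+* S) (q : ℕ) (z : ι → R)
    (c : (ι → Fin q) → R) :
    f (expF q z c) = expF q (fun i => f (z i)) (fun b => f (c b)) := by
  simp [expF, monom, map_sum, map_prod]

theorem expF_dvd (q : ℕ) (z : ι → R) (x : R) (c : (ι → Fin q) → R) (h : ∀ b, x ∣ c b) :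
    x ^ q ∣ expF q z c :=
  Finset.dvd_sum fun b _ => Dvd.dvd.mul_right (pow_dvd_pow_of_dvd (h b) q) _

theorem dvd_of_expF_dvd (q : ℕ) (hq : q ≠ 0) (z : ι → R) (x : R)
    (hz : Function.Injective (expF q (fun i => Ideal.Quotient.mk (Ideal.span {x}) (z i))))
    (c : (ι → Fin q) → R) (h : x ∣ expF q z c) (b : ι → Fin q) : x ∣ c b := by
  rw [← Ideal.mem_span_singleton, ← Ideal.Quotient.eq_zero_iff_mem] at h ⊢
  rw [expF_map] at h
  have h0 : expF q (fun i => Ideal.Quotient.mk (Ideal.span {x}) (z i)) (fun _ => 0) = 0 := by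
    simp [expF, hq]
  exact congrFun (hz (h.trans h0.symm)) b

theorem step_inj_aux (q : ℕ) (z : ι → R) (x : R)
    (hxr : ∀ a b : R, x * a = x * b → a = b)
    (hz : Function.Injective (expF q (fun i => Ideal.Quotient.mk (Ideal.span {x}) (z i))))
    (c : (Option ι → Fin q) → R) (h : x ^ q ∣ expF q (consO x z) c) :
    ∀ b, x ∣ c b := by
  have hxn : ∀ n (a b : R), x ^ n * a = x ^ n * b → a = b := by
    intro n
    induction n with
    | zero => intro a b h; simpa using h
    | succ n ih =>
      intro a b h
      rw [pow_succ, mul_assoc, mul_assoc] at h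
      exact hxr _ _ (ih _ _ h)
  rw [expF_option] at h
  have key : ∀ n, ∀ hn : n < q, ∀ b, x ∣ c (consO ⟨n, hn⟩ b) := by
    intro n
    induction n using Nat.strong_induction_on with
    | _ n ih =>
      intro hn
      have h1 : x ^ (n + 1) ∣ ∑ j ∈ Finset.univ.erase (⟨n, hn⟩ : Fin q),
          x ^ (j : ℕ) * expF q z (fun b => c (consO j b)) := by
        refine Finset.dvd_sum fun j hj => ?_
        have hj' : (j : ℕ) ≠ n := fun h => (Finset.ne_of_mem_erase hj) (Fin.ext h)
        rcases lt_or_gt_of_ne hj' with hlt | hgt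
        · exact Dvd.dvd.mul_left ((pow_dvd_pow x hn).trans
            (expF_dvd q z x _ (ih j hlt j.2))) _
        · exact Dvd.dvd.mul_right (pow_dvd_pow x hgt) _
      have h2 := (pow_dvd_pow x (show n + 1 ≤ q from hn)).trans h
      rw [← Finset.add_sum_erase _ _ (Finset.mem_univ (⟨n, hn⟩ : Fin q))] at h2
      have h3 := (dvd_add_left h1).mp h2
      obtain ⟨t, ht⟩ := h3
      rw [pow_succ, mul_assoc] at ht
      exact dvd_of_expF_dvd q (by omega) z x hz _ ⟨t, hxn _ _ _ ht⟩
  intro b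
  rw [← consO_eta b]
  exact key _ (b none).2 _

theorem step_inj [IsLocalRing R] [IsNoetherianRing R] (p : ℕ) [hp : Fact p.Prime] [CharP R p]
    (e q : ℕ) (hq : q = p ^ e) (z : ι → R) (x : R) (hxm : x ∈ IsLocalRing.maximalIdeal R)
    (hxr : ∀ a b : R, x * a = x * b → a = b)
    (hz : Function.Injective (expF q (fun i => Ideal.Quotient.mk (Ideal.span {x}) (z i)))) :
    Function.Injective (expF q (consO x z)) := by
  have hq0 : q ≠ 0 := hq ▸ pow_ne_zero e hp.out.ne_zero
  have hxn : ∀ n (a b : R), x ^ n * a = x ^ n * b → a = b := by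
    intro n
    induction n with
    | zero => intro a b h; simpa using h
    | succ n ih =>
      intro a b h
      rw [pow_succ, mul_assoc, mul_assoc] at h
      exact hxr _ _ (ih _ _ h)
  have key : ∀ n (c : (Option ι → Fin q) → R), expF q (consO x z) c = 0 → ∀ b, x ^ n ∣ c b := by
    intro n
    induction n with
    | zero => intro c _ b; simp
    | succ n ih =>
      intro c hc b
      have h1 := step_inj_aux q z x hxr hz c (hc ▸ dvd_zero _)
      choose d hd using h1
      have h2 : c = fun b => x * d b := funext hd
      rw [h2, expF_mul] at hc
      have h3 := ih d (hxn q _ _ (by rw [hc, mul_zero])) b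
      rw [hd b, pow_succ']
      exact mul_dvd_mul_left x h3
  have hker : ∀ c : (Option ι → Fin q) → R, expF q (consO x z) c = 0 → c = 0 := by
    intro c hc
    ext b
    have hne : Ideal.span {x} ≠ ⊤ := by
      intro h
      rw [Ideal.span_singleton_eq_top] at h
      exact (IsLocalRing.mem_maximalIdeal x).mp hxm h
    have h1 := Ideal.iInf_pow_eq_bot_of_isLocalRing (Ideal.span {x}) hne
    have h2 : c b ∈ (⨅ i : ℕ, Ideal.span {x} ^ i) := by
      rw [Ideal.mem_iInf]
      intro i
      rw [Ideal.span_singleton_pow, Ideal.mem_span_singleton]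
      exact key i c hc b
    rw [h1] at h2
    simpa using h2
  subst hq
  exact (injective_iff_map_eq_zero (expFHom p e (consO x z))).mpr hker

theorem step_surj [IsLocalRing R] (p : ℕ) [hp : Fact p.Prime] [CharP R p]
    (hF : Module.Finite (↥(frobenius R p).range) R)
    (z : ι → R) (x : R) (hxm : x ∈ IsLocalRing.maximalIdeal R)
    (hz : Function.Surjective (expF p (fun i => Ideal.Quotient.mk (Ideal.span {x}) (z i)))) :
    Function.Surjective (expF p (consO x z)) := by
  have hadd : ∀ c d, expF p (consO x z) (c + d) = expF p (consO x z) c + expF p (consO x z) d := by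
    have : ∀ q, q = p ^ 1 → ∀ c d, expF q (consO x z) (c + d) =
        expF q (consO x z) c + expF q (consO x z) d := by
      rintro q rfl; exact expF_add p 1 _
    exact this p (pow_one p).symm
  have h1 : ∀ t : R, ∃ c t', t = expF p z c + x * t' := by
    intro t
    obtain ⟨c, hc⟩ := hz (Ideal.Quotient.mk _ t)
    choose d hd using fun b => Ideal.Quotient.mk_surjective (c b)
    have h2 : c = fun b => Ideal.Quotient.mk (Ideal.span {x}) (d b) := funext fun b => (hd b).symm
    rw [h2, ← expF_map] at hc
    have h3 := (Ideal.Quotient.eq.mp hc.symm)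
    obtain ⟨t', ht'⟩ := Ideal.mem_span_singleton.mp h3
    exact ⟨d, t', by rw [← ht']; ring⟩
  have h2 : ∀ (r : R) (n : ℕ), ∃ (c : ℕ → (ι → Fin p) → R) (t : R),
      r = ∑ j ∈ Finset.range n, x ^ j * expF p z (c j) + x ^ n * t := by
    intro r n
    induction n with
    | zero => exact ⟨fun _ _ => 0, r, by simp⟩
    | succ n ih =>
      obtain ⟨c, t, h⟩ := ih
      obtain ⟨d, t', ht⟩ := h1 t
      refine ⟨Function.update c n d, t', ?_⟩
      rw [Finset.sum_range_succ, Function.update_self]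
      have : ∑ j ∈ Finset.range n, x ^ j * expF p z (Function.update c n d j) =
          ∑ j ∈ Finset.range n, x ^ j * expF p z (c j) := by
        refine Finset.sum_congr rfl fun j hj => ?_
        rw [Function.update_of_ne (by have := Finset.mem_range.mp hj; omega)]
      rw [this, h]
      conv_lhs => rw [ht]
      ring
  have h3 : ∀ r : R, ∃ c t, r = expF p (consO x z) c + x ^ p * t := by
    intro r
    obtain ⟨c, t, h⟩ := h2 r p
    refine ⟨fun b => c (b none) (fun i => b (some i)), t, ?_⟩
    rw [expF_option, h]
    congr 1
    rw [← Fin.sum_univ_eq_sum_range (fun j => x ^ j * expF p z (c j))]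
    rfl
  let A := (frobenius R p).range
  have hA : IsLocalRing A :=
    IsLocalRing.of_surjective' (frobenius R p).rangeRestrict (frobenius R p).rangeRestrict_surjective
  let N : Submodule A R :=
    { carrier := Set.range (expF p (consO x z))
      add_mem' := by
        rintro _ _ ⟨c, rfl⟩ ⟨d, rfl⟩
        exact ⟨c + d, hadd c d⟩
      zero_mem' := ⟨fun _ => 0, by simp [expF, hp.out.ne_zero]⟩
      smul_mem' := by
        rintro ⟨_, u, rfl⟩ _ ⟨c, rfl⟩
        exact ⟨fun b => u * c b, expF_mul p _ u c⟩ }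
  let xp : A := ⟨x ^ p, x, rfl⟩
  have hxp : Ideal.span {xp} ≤ Ideal.jacobson ⊥ := by
    rw [IsLocalRing.jacobson_eq_maximalIdeal _ bot_ne_top, Ideal.span_singleton_le_iff_mem,
      IsLocalRing.mem_maximalIdeal]
    intro hu
    have h4 : IsUnit (x ^ p) := hu.map A.subtype
    exact (IsLocalRing.mem_maximalIdeal x).mp hxm ((isUnit_pow_iff hp.out.ne_zero).mp h4)
  have hN : (⊤ : Submodule A R) ≤ N := by
    refine Submodule.le_of_le_smul_of_le_jacobson_bot (Module.Finite.fg_top) hxp ?_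
    intro r _
    obtain ⟨c, t, h⟩ := h3 r
    rw [h]
    refine Submodule.add_mem_sup ⟨c, rfl⟩ ?_
    exact Submodule.smul_mem_smul (Ideal.mem_span_singleton_self xp) (Submodule.mem_top (x := t))
  intro r
  exact hN (Submodule.mem_top (x := r))

/-- combine exponents -/
def combE (a b : ℕ) : (ι → Fin b) × (ι → Fin a) ≃ (ι → Fin (b * a)) :=
  (Equiv.arrowProdEquivProdArrow ι (fun _ => Fin b) (fun _ => Fin a)).symm.trans
    (Equiv.arrowCongr (Equiv.refl ι) finProdFinEquiv)

theorem expF_comb (p : ℕ) [hp : Fact p.Prime] [CharP R p] (b : ℕ) (z : ι → R)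
    (d : (ι → Fin (b * p)) → R) :
    expF (b * p) z d = expF p z (fun s => expF b z (fun t => d (combE p b (t, s)))) := by
  unfold expF
  rw [← (combE p b).sum_comp, Fintype.sum_prod_type_right]
  refine Finset.sum_congr rfl fun s _ => ?_
  rw [sum_pow_char, Finset.sum_mul]
  refine Finset.sum_congr rfl fun t _ => ?_
  rw [mul_pow, ← pow_mul, mul_assoc]
  congr 1
  unfold monom
  rw [← Finset.prod_pow, ← Finset.prod_mul_distrib]
  refine Finset.prod_congr rfl fun i _ => ?_
  rw [← pow_mul, ← pow_add]
  congr 1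
  change (finProdFinEquiv (t i, s i) : ℕ) = _
  rw [finProdFinEquiv_apply_val]
  ring

theorem bij_pow (p : ℕ) [hp : Fact p.Prime] [CharP R p] (z : ι → R)
    (hz : Function.Bijective (expF p z)) (e : ℕ) : Function.Bijective (expF (p ^ e) z) := by
  induction e with
  | zero =>
    have h : ∀ q, q = 1 → Function.Bijective (expF q z) := by
      rintro q rfl
      have h1 : ∀ c, expF 1 z c = c default := by
        intro c
        unfold expF monom
        rw [Fintype.sum_unique]
        simp
      constructor
      · intro c d h
        rw [h1, h1] at h
        ext b
        rw [Subsingleton.elim b default, h]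
      · intro r
        exact ⟨fun _ => r, h1 _⟩
    exact h _ (pow_zero p)
  | succ e ih =>
    have h : ∀ q, q = p ^ e * p → Function.Bijective (expF q z) := by
      rintro q rfl
      constructor
      · intro c d h
        rw [expF_comb, expF_comb] at h
        have h1 := hz.1 h
        ext b
        obtain ⟨⟨t, s⟩, rfl⟩ := (combE p (p ^ e)).surjective b
        exact congrFun (ih.1 (congrFun h1 s)) t
      · intro r
        obtain ⟨c, rfl⟩ := hz.2 r
        choose d hd using fun s => ih.2 (c s)
        refine ⟨fun b => d ((combE p (p ^ e)).symm b).2 ((combE p (p ^ e)).symm b).1, ?_⟩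
        rw [expF_comb]
        congr 1
        ext s
        simp only [Equiv.symm_apply_apply]
        exact hd s
    exact h _ (pow_succ p e)

end StepPart

section FieldPart

theorem expF_add_p {R ι : Type*} [CommRing R] [Fintype ι] [DecidableEq ι]
    (p : ℕ) [hp : Fact p.Prime] [CharP R p] (z : ι → R) (c d : (ι → Fin p) → R) :
    expF p z (c + d) = expF p z c + expF p z d := by
  have : ∀ q, q = p ^ 1 → ∀ c d, expF q z (c + d) = expF q z c + expF q z d := by
    rintro q rfl; exact expF_add p 1 _
  exact this p (pow_one p).symm c d

theorem expF_inj_of_ker {R ι : Type*} [CommRing R] [Fintype ι] [DecidableEq ι]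
    (p : ℕ) [hp : Fact p.Prime] [CharP R p] (z : ι → R)
    (h : ∀ c, expF p z c = 0 → c = 0) : Function.Injective (expF p z) :=
  (injective_iff_map_eq_zero (AddMonoidHom.mk' (expF p z) (expF_add_p p z))).mpr h

variable {K : Type*} [Field K] (p : ℕ) [hp : Fact p.Prime] [CharP K p]

theorem pow_indep (W : Subfield K) (y : K) (hy : y ∉ W) (hyp : y ^ p ∈ W) (w : Fin p → K)
    (hw : ∀ j, w j ∈ W) (h : ∑ j : Fin p, y ^ (j : ℕ) * w j = 0) : ∀ j, w j = 0 := by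
  have hirr : Irreducible (Polynomial.X ^ p - Polynomial.C (⟨y ^ p, hyp⟩ : W)) := by
    refine X_pow_sub_C_irreducible_of_prime hp.out ?_
    intro b hb
    apply hy
    have h1 : (b : K) ^ p = y ^ p := congrArg Subtype.val hb
    have h2 : (b : K) = y := frobenius_inj K p h1
    rw [← h2]; exact b.2
  have hmin : Polynomial.X ^ p - Polynomial.C (⟨y ^ p, hyp⟩ : W) = minpoly W y := by
    refine minpoly.eq_of_irreducible_of_monic hirr ?_
      (Polynomial.monic_X_pow_sub_C _ hp.out.ne_zero)
    simp only [map_sub, map_pow, Polynomial.aeval_X, Polynomial.aeval_C]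
    exact sub_self _
  have hdeg : (minpoly W y).natDegree = p := by
    rw [← hmin, Polynomial.natDegree_X_pow_sub_C]
  have hli : ∀ n, (minpoly W y).natDegree = n →
      LinearIndependent W (fun i : Fin n => y ^ (i : ℕ)) := by
    rintro _ rfl
    exact linearIndependent_pow y
  have h1 := Fintype.linearIndependent_iff.mp (hli p hdeg) (fun j => ⟨w j, hw j⟩) (by
    rw [← h]
    refine Finset.sum_congr rfl fun j _ => ?_
    rw [mul_comm]; rfl)
  intro j
  exact congrArg Subtype.val (h1 j)

theorem exists_subfield {ι : Type*} [Fintype ι] [DecidableEq ι] (z : ι → K) :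
    ∃ W : Subfield K, (W : Set K) = Set.range (expF p z) := by
  have : NeZero p := ⟨hp.out.ne_zero⟩
  have hzero : (0 : K) ∈ Set.range (expF p z) :=
    ⟨fun _ => 0, by simp [expF, hp.out.ne_zero]⟩
  let W0 : AddSubmonoid K :=
    { carrier := Set.range (expF p z)
      add_mem' := by
        rintro _ _ ⟨c, rfl⟩ ⟨d, rfl⟩
        exact ⟨c + d, expF_add_p p z c d⟩
      zero_mem' := hzero }
  have hmon : ∀ g, monom z g ∈ W0 := fun g => ⟨_, (monom_eq_expF p z g).symm⟩
  have hpow : ∀ (a r : K), r ∈ W0 → a ^ p * r ∈ W0 := by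
    rintro a _ ⟨c, rfl⟩
    exact ⟨_, expF_mul p z a c⟩
  have hone : (1 : K) ∈ W0 := monom_zero z ▸ hmon 0
  have hmul : ∀ a b : K, a ∈ W0 → b ∈ W0 → a * b ∈ W0 := by
    rintro _ _ ⟨c, rfl⟩ ⟨d, rfl⟩
    unfold expF
    rw [Finset.sum_mul_sum]
    refine sum_mem fun s _ => sum_mem fun t _ => ?_
    have : c s ^ p * monom z (fun i => (s i : ℕ)) * (d t ^ p * monom z (fun i => (t i : ℕ))) =
        (c s * d t) ^ p * monom z ((fun i => (s i : ℕ)) + (fun i => (t i : ℕ))) := by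
      rw [monom_add]; ring
    rw [this]
    exact hpow _ _ (hmon _)
  have hpw : ∀ a : K, a ^ p ∈ W0 := fun a => by simpa using hpow a 1 hone
  refine ⟨{ carrier := Set.range (expF p z)
            add_mem' := W0.add_mem
            zero_mem' := W0.zero_mem
            mul_mem' := fun {a b} ha hb => hmul a b ha hb
            one_mem' := hone
            neg_mem' := ?_
            inv_mem' := ?_ }, rfl⟩
  · rintro _ ⟨c, rfl⟩
    refine ⟨fun b => (-1) * c b, ?_⟩
    rw [expF_mul]
    have : (-1 : K) ^ p = -1 := by
      have := map_neg (frobenius K p) 1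
      simpa [frobenius_def] using this
    rw [this]; ring
  · intro a ha
    by_cases h0 : a = 0
    · subst h0; rw [inv_zero]; exact hzero
    have h1 : ∀ n, a ^ n ∈ W0 := by
      intro n
      induction n with
      | zero => simpa using hone
      | succ n ih => rw [pow_succ]; exact hmul _ _ ih ha
    have h2 : a⁻¹ = a⁻¹ ^ p * a ^ (p - 1) := by
      obtain ⟨m, hm⟩ := Nat.exists_eq_succ_of_ne_zero hp.out.ne_zero
      rw [hm, Nat.succ_sub_one, pow_succ', mul_assoc, ← mul_pow, inv_mul_cancel₀ h0,
        one_pow, mul_one]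
    rw [h2]
    exact hpow _ _ (h1 _)

theorem field_basis (hF : Module.Finite (↥(frobenius K p).range) K) :
    ∃ (ι : Type) (_ : Fintype ι) (_ : DecidableEq ι) (z : ι → K),
      Function.Bijective (expF p z) := by
  by_contra hcon
  have key : ∀ n : ℕ, ∃ (ι : Type) (_ : Fintype ι) (_ : DecidableEq ι) (z : ι → K),
      Function.Injective (expF p z) ∧ Fintype.card ι = n := by
    intro n
    induction n with
    | zero =>
      refine ⟨Fin 0, inferInstance, inferInstance, fun _ => 0, ?_, by simp⟩
      refine expF_inj_of_ker p _ fun c hc => ?_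
      unfold expF monom at hc
      rw [Fintype.sum_unique] at hc
      ext b
      rw [Finset.univ_eq_empty, Finset.prod_empty, mul_one] at hc
      have h5 := (pow_eq_zero_iff hp.out.ne_zero).mp hc
      exact (congrArg c (Subsingleton.elim _ _)).trans h5
    | succ n ih =>
      obtain ⟨ι, i1, i2, z, hz, hcard⟩ := ih
      have hns : ¬ Function.Surjective (expF p z) := fun hs => hcon ⟨ι, i1, i2, z, hz, hs⟩
      rw [Function.Surjective] at hns
      push Not at hns
      obtain ⟨y, hy⟩ := hns
      obtain ⟨W, hW⟩ := exists_subfield p z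
      have hmem : ∀ a, a ∈ W ↔ ∃ c, expF p z c = a := fun a => by
        rw [← SetLike.mem_coe, hW]; rfl
      have : NeZero p := ⟨hp.out.ne_zero⟩
      refine ⟨Option ι, inferInstance, inferInstance, consO y z, ?_, by simp [hcard]⟩
      refine expF_inj_of_ker p _ fun c hc => ?_
      rw [expF_option] at hc
      have h1 := pow_indep p W y (fun h => by
          obtain ⟨c, hc⟩ := (hmem y).mp h
          exact hy c hc)
        ((hmem _).mpr ⟨Pi.single 0 y, by
          rw [expF_single p hp.out.ne_zero]; simp [monom]⟩) _
        (fun j => (hmem _).mpr ⟨_, rfl⟩) hc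
      ext b
      have h2 := h1 (b none)
      have h0 : expF p z (fun _ => 0) = 0 := by simp [expF, hp.out.ne_zero]
      have h3 := congrFun (hz (h2.trans h0.symm)) (fun i => b (some i))
      rw [consO_eta] at h3
      exact h3
  obtain ⟨ι, i1, i2, z, hz, hcard⟩ := key (Module.finrank (↥(frobenius K p).range) K)
  have hli : LinearIndependent (↥(frobenius K p).range)
      (fun b : ι → Fin p => monom z (fun i => (b i : ℕ))) := by
    rw [Fintype.linearIndependent_iff]
    intro g hg
    choose u hu using fun b => (g b).2
    have h1 : expF p z u = 0 := by
      rw [← hg]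
      unfold expF
      refine Finset.sum_congr rfl fun b _ => ?_
      rw [Subring.smul_def, ← hu b]; rfl
    have h0 : expF p z (fun _ => 0) = 0 := by simp [expF, hp.out.ne_zero]
    intro b
    have h2 := congrFun (hz (h1.trans h0.symm)) b
    apply Subtype.ext
    rw [← hu b]
    rw [h2]; simp
  have h4 := hli.fintype_card_le_finrank
  rw [Fintype.card_fun, Fintype.card_fin, hcard] at h4
  exact absurd h4 (not_le.mpr (Nat.lt_pow_self hp.out.one_lt))

end FieldPart

section RegularPart

open scoped Pointwise

theorem finite_quot {R : Type*} [CommRing R] (p : ℕ) [hp : Fact p.Prime] [CharP R p]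
    (hF : Module.Finite (↥(frobenius R p).range) R) (I : Ideal R) [CharP (R ⧸ I) p] :
    Module.Finite (↥(frobenius (R ⧸ I) p).range) (R ⧸ I) := by
  classical
  obtain ⟨m, s, hs⟩ := Module.Finite.exists_fin (R := ↥(frobenius R p).range) (M := R)
  refine Module.finite_def.mpr ⟨(Finset.univ.image fun i => Ideal.Quotient.mk I (s i)), ?_⟩
  rw [eq_top_iff]
  rintro t -
  obtain ⟨r, rfl⟩ := Ideal.Quotient.mk_surjective t
  have hr : r ∈ Submodule.span (↥(frobenius R p).range) (Set.range s) := hs ▸ Submodule.mem_top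
  obtain ⟨c, rfl⟩ := (Submodule.mem_span_range_iff_exists_fun _).mp hr
  rw [map_sum]
  refine sum_mem fun i _ => ?_
  obtain ⟨u, hu⟩ := (c i).2
  have h1 : Ideal.Quotient.mk I (c i • s i) =
      (⟨(Ideal.Quotient.mk I u) ^ p, Ideal.Quotient.mk I u, rfl⟩ :
        (frobenius (R ⧸ I) p).range) • Ideal.Quotient.mk I (s i) := by
    rw [Subring.smul_def, Subring.smul_def, ← hu]
    simp [frobenius_def]
  rw [h1]
  refine Submodule.smul_mem _ _ (Submodule.subset_span ?_)
  simp

theorem charP_quot {R : Type*} [CommRing R] (p : ℕ) [hp : Fact p.Prime] [CharP R p]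
    (I : Ideal R) [Nontrivial (R ⧸ I)] : CharP (R ⧸ I) p := by
  have hpT : (p : R ⧸ I) = 0 := by
    rw [← map_natCast (Ideal.Quotient.mk I), CharP.cast_eq_zero, map_zero]
  obtain ⟨r, hr⟩ := CharP.exists (R ⧸ I)
  have h1 : r ∣ p := (CharP.cast_eq_zero_iff (R ⧸ I) r p).mp hpT
  rcases (Nat.dvd_prime hp.out).mp h1 with h | h
  · exact absurd h (CharP.char_ne_one (R ⧸ I) r)
  · exact h ▸ hr

theorem basis_step {R : Type*} [CommRing R] [IsLocalRing R] [IsNoetherianRing R]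
    (p : ℕ) [hp : Fact p.Prime] [CharP R p]
    (hF : Module.Finite (↥(frobenius R p).range) R) (x : R)
    (hxm : x ∈ IsLocalRing.maximalIdeal R) (hxr : ∀ a b : R, x * a = x * b → a = b)
    {ι : Type} [Fintype ι] [DecidableEq ι] (z : ι → R)
    (hz : Function.Bijective (expF p (fun i => Ideal.Quotient.mk (Ideal.span {x}) (z i)))) :
    Function.Bijective (expF p (consO x z)) :=
  ⟨step_inj p 1 p (pow_one p).symm z x hxm hxr hz.1, step_surj p hF z x hxm hz.2⟩

theorem reg_basis.{u} (p : ℕ) [hp : Fact p.Prime] (n : ℕ) :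
    ∀ (R : Type u) [CommRing R] [IsLocalRing R] [IsNoetherianRing R] [CharP R p]
    (_ : Module.Finite (↥(frobenius R p).range) R) (rs : List R) (_ : rs.length = n)
    (_ : RingTheory.Sequence.IsWeaklyRegular R rs)
    (_ : Ideal.span {x | x ∈ rs} = IsLocalRing.maximalIdeal R),
    ∃ (ι : Type) (_ : Fintype ι) (_ : DecidableEq ι) (z : ι → R),
      Function.Bijective (expF p z) := by
  induction n with
  | zero =>
    intro R _ _ _ _ hF rs hlen _ hspan
    rw [List.length_eq_zero_iff] at hlen
    subst hlen
    have hbot : IsLocalRing.maximalIdeal R = ⊥ := by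
      rw [← hspan]; simp
    have hfield : IsField R := IsLocalRing.isField_iff_maximalIdeal_eq.mpr hbot
    let _ := hfield.toField
    exact field_basis p hF
  | succ n ih =>
    intro R _ _ _ _ hF rs hlen hreg hspan
    obtain ⟨x, rs', rfl⟩ := List.exists_cons_of_length_eq_add_one hlen
    rw [RingTheory.Sequence.isWeaklyRegular_cons_iff'] at hreg
    obtain ⟨hx, hreg'⟩ := hreg
    have hxm : x ∈ IsLocalRing.maximalIdeal R := by
      rw [← hspan]; exact Ideal.subset_span (by simp)
    have hne : Ideal.span {x} ≠ ⊤ := by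
      intro h
      rw [Ideal.span_singleton_eq_top] at h
      exact (IsLocalRing.mem_maximalIdeal x).mp hxm h
    have hnt : Nontrivial (R ⧸ Ideal.span {x}) := Ideal.Quotient.nontrivial_iff.mpr hne
    have hloc : IsLocalRing (R ⧸ Ideal.span {x}) :=
      IsLocalRing.of_surjective' (Ideal.Quotient.mk _) Ideal.Quotient.mk_surjective
    have hchar := charP_quot p (Ideal.span {x})
    have hF' := finite_quot p hF (Ideal.span {x})
    have heq : (x • (⊤ : Submodule R R)) = Ideal.span {x} := by
      ext y
      rw [Submodule.mem_smul_pointwise_iff_exists, Ideal.mem_span_singleton]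
      constructor
      · rintro ⟨a, -, rfl⟩; exact ⟨a, rfl⟩
      · rintro ⟨a, rfl⟩; exact ⟨a, trivial, rfl⟩
    let E : QuotSMulTop x R ≃ₗ[R] (R ⧸ Ideal.span {x}) := Submodule.quotEquivOfEq _ _ heq
    have hreg2 : RingTheory.Sequence.IsWeaklyRegular (R ⧸ Ideal.span {x})
        (rs'.map (Ideal.Quotient.mk (Ideal.span {x}))) := by
      refine (AddEquiv.isWeaklyRegular_congr (e := E.toAddEquiv) ?_).mp hreg'
      refine List.forall₂_same.mpr ?_
      intro r _ y
      obtain ⟨r, rfl⟩ := Ideal.Quotient.mk_surjective r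
      have h1 : (Ideal.Quotient.mk (Ideal.span {x}) r) • y = r • y := rfl
      have h2 : ∀ w : R ⧸ Ideal.span {x}, (Ideal.Quotient.mk (Ideal.span {x}) r) • w = r • w :=
        fun w => algebraMap_smul (R ⧸ Ideal.span {x}) r w
      rw [h1, h2]
      exact E.map_smul r y
    have hspan2 : Ideal.span {y | y ∈ rs'.map (Ideal.Quotient.mk (Ideal.span {x}))} =
        IsLocalRing.maximalIdeal (R ⧸ Ideal.span {x}) := by
      have h1 : (IsLocalRing.maximalIdeal R).map (Ideal.Quotient.mk (Ideal.span {x})) =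
          IsLocalRing.maximalIdeal (R ⧸ Ideal.span {x}) := by
        refine IsLocalRing.eq_maximalIdeal ?_
        refine (Ideal.map_eq_top_or_isMaximal_of_surjective _ Ideal.Quotient.mk_surjective
          (IsLocalRing.maximalIdeal.isMaximal R)).resolve_left ?_
        intro htop
        have h2 := congrArg (Ideal.comap (Ideal.Quotient.mk (Ideal.span {x}))) htop
        rw [Ideal.comap_map_of_surjective _ Ideal.Quotient.mk_surjective, Ideal.comap_top,
          ← RingHom.ker_eq_comap_bot, Ideal.mk_ker, sup_eq_left.mpr] at h2
        · exact (IsLocalRing.maximalIdeal.isMaximal R).ne_top h2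
        · rw [Ideal.span_singleton_le_iff_mem]; exact hxm
      rw [← h1, ← hspan, Ideal.map_span]
      apply le_antisymm
      · refine Ideal.span_mono ?_
        intro y hy
        obtain ⟨r, hr, rfl⟩ := List.mem_map.mp hy
        exact ⟨r, by simp [hr], rfl⟩
      · rw [Ideal.span_le]
        rintro _ ⟨r, hr, rfl⟩
        rcases List.mem_cons.mp hr with rfl | hr
        · have : Ideal.Quotient.mk (Ideal.span {r}) r = 0 :=
            Ideal.Quotient.eq_zero_iff_mem.mpr (Ideal.mem_span_singleton_self r)
          rw [this]; exact Ideal.zero_mem _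
        · exact Ideal.subset_span (List.mem_map.mpr ⟨r, hr, rfl⟩)
    obtain ⟨ι, i1, i2, w, hw⟩ := ih (R ⧸ Ideal.span {x}) hF'
      (rs'.map (Ideal.Quotient.mk (Ideal.span {x}))) (by simpa using hlen) hreg2 hspan2
    choose z hz using fun i => Ideal.Quotient.mk_surjective (w i)
    have hwz : w = fun i => Ideal.Quotient.mk (Ideal.span {x}) (z i) := funext fun i => (hz i).symm
    rw [hwz] at hw
    exact ⟨Option ι, inferInstance, inferInstance, consO x z,
      basis_step p hF x hxm (fun a b h => hx h) z hw⟩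

theorem key_lemma {R : Type*} [CommRing R] (p : ℕ) [hp : Fact p.Prime] [CharP R p] (e : ℕ)
    (x : R) {ι : Type} [Fintype ι] [DecidableEq ι] (z : ι → R)
    (hS : Function.Injective (expF (p ^ e)
      (fun i => Ideal.Quotient.mk (Ideal.span {x}) (z i))))
    (hR : Function.Bijective (expF (p ^ e) (consO x z)))
    (g : R) (hg : ∀ D : R →+ R, IsDiffOp R (p ^ e - 1) D → D 1 = 0 → x ∣ D g) :
    ∃ lam : R, x ^ p ^ e ∣ g - lam ^ p ^ e := by
  have hq0 : p ^ e ≠ 0 := pow_ne_zero e hp.out.ne_zero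
  have : NeZero (p ^ e) := ⟨hq0⟩
  obtain ⟨c, rfl⟩ := hR.2 g
  have hind : ∀ d : (Option ι → Fin (p ^ e)) → R, x ∣ expF (p ^ e) (consO x z) d →
      ∀ b, b none = 0 → x ∣ d b := by
    intro d hd b hb
    rw [expF_option, ← Finset.add_sum_erase _ _ (Finset.mem_univ (0 : Fin (p ^ e)))] at hd
    have h1 : x ∣ ∑ j ∈ Finset.univ.erase (0 : Fin (p ^ e)),
        x ^ (j : ℕ) * expF (p ^ e) z (fun b => d (consO j b)) := by
      refine Finset.dvd_sum fun j hj => Dvd.dvd.mul_right (dvd_pow_self x ?_) _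
      intro h
      exact Finset.ne_of_mem_erase hj (Fin.ext (by simpa using h))
    have h2 := (dvd_add_left h1).mp hd
    rw [Fin.val_zero, pow_zero, one_mul] at h2
    have h3 := dvd_of_expF_dvd (p ^ e) hq0 z x hS _ h2 (fun i => b (some i))
    rwa [← hb, consO_eta] at h3
  have hc : ∀ b, b ≠ 0 → x ∣ c b := by
    intro b hb
    have h1 : ∃ i, b i ≠ 0 ∧ (Function.update b i 0) none = 0 := by
      by_cases h : b none = 0
      · obtain ⟨i, hi⟩ := Function.ne_iff.mp hb
        refine ⟨i, hi, ?_⟩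
        by_cases h2 : none = i
        · subst h2; simp
        · rw [Function.update_of_ne h2, h]
      · exact ⟨none, h, by simp⟩
    obtain ⟨i, hi, h0⟩ := h1
    obtain ⟨D, hD1, hD2, hD3⟩ := exists_diffOp_s14 p e (consO x z) hR i (b i)
    have h2 := hg D hD1 (hD2 hi)
    rw [hD3] at h2
    have h3 := hind _ h2 _ h0
    rw [shiftC_apply, if_pos (by simp), Function.update_idem, Function.update_eq_self] at h3
    exact h3
  refine ⟨c 0, ?_⟩
  have h4 : expF (p ^ e) (consO x z) c - c 0 ^ p ^ e =
      ∑ b ∈ Finset.univ.erase (0 : Option ι → Fin (p ^ e)),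
        c b ^ p ^ e * monom (consO x z) (fun i => (b i : ℕ)) := by
    unfold expF
    rw [← Finset.add_sum_erase _ _ (Finset.mem_univ (0 : Option ι → Fin (p ^ e)))]
    have : monom (consO x z) (fun i => (((0 : Option ι → Fin (p ^ e)) i : Fin (p ^ e)) : ℕ)) = 1 := by
      simp [monom]
    rw [this]; ring
  rw [h4]
  exact Finset.dvd_sum fun b hb => Dvd.dvd.mul_right
    (pow_dvd_pow_of_dvd (hc b (Finset.ne_of_mem_erase hb)) _) _

end RegularPart

/-- Let `(R, m)` be an `F`-finite regular local ring of characteristic `p > 0`,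
`q = p ^ e`, `x ≠ 0` with `R / xR` regular, `f ∉ R ^ q`.  If `n` is the largest integer
with `Diff_{R,+}^{q-1}(f) ⊆ x ^ n R` and `a` the largest integer with
`f ∈ R ^ q + x ^ (q a) R`, then `n = q a`. -/
theorem largest_diffOp_exponent_eq_q_mul
    (R : Type*) [CommRing R] [IsDomain R] [IsLocalRing R] (hreg : IsRegularLocal R)
    (p : ℕ) [Fact p.Prime] [CharP R p]
    (hF : Module.Finite (↥(frobenius R p).range) R)
    (e q : ℕ) (hq : q = p ^ e)
    (x : R) (hx0 : x ≠ 0) [IsLocalRing (R ⧸ Ideal.span {x})]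
    (hxreg : IsRegularLocal (R ⧸ Ideal.span {x}))
    (f : R) (hf : ¬ ∃ u : R, f = u ^ q) (n a : ℕ)
    (hn1 : ∀ D : R →+ R, IsDiffOp R (q - 1) D → D 1 = 0 → D f ∈ Ideal.span {x ^ n})
    (hn2 : ∀ m : ℕ,
      (∀ D : R →+ R, IsDiffOp R (q - 1) D → D 1 = 0 → D f ∈ Ideal.span {x ^ m}) → m ≤ n)
    (ha1 : ∃ lam : R, f - lam ^ q ∈ Ideal.span {x ^ (q * a)})
    (ha2 : ∀ b : ℕ, (∃ lam : R, f - lam ^ q ∈ Ideal.span {x ^ (q * b)}) → b ≤ a) :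
    n = q * a := by
  subst hq
  have hq0 : p ^ e ≠ 0 := pow_ne_zero e (Fact.out : p.Prime).ne_zero
  simp only [Ideal.mem_span_singleton] at hn1 hn2 ha1 ha2
  obtain ⟨lam, g, hg⟩ := ha1
  have hfg : f = lam ^ p ^ e * 1 + (x ^ a) ^ p ^ e * g := by
    rw [← pow_mul, mul_comm a, ← hg]; ring
  have hDf : ∀ D : R →+ R, IsDiffOp R (p ^ e - 1) D → D 1 = 0 →
      D f = x ^ (p ^ e * a) * D g := by
    intro D hD h1
    rw [hfg, map_add, IsDiffOp.map_pow_mul p e D hD, IsDiffOp.map_pow_mul p e D hD, h1,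
      ← pow_mul, mul_comm a]
    ring
  have hle : p ^ e * a ≤ n := hn2 _ fun D hD h1 => ⟨D g, hDf D hD h1⟩
  refine le_antisymm ?_ hle
  by_contra hlt
  rw [not_le] at hlt
  obtain ⟨hnoeth, -, -, -⟩ := hreg
  obtain ⟨hnoeth', rs, hrs, hspan⟩ := hxreg
  have hchar := charP_quot p (Ideal.span {x})
  have hF' := finite_quot p hF (Ideal.span {x})
  obtain ⟨ι, i1, i2, w, hw⟩ := reg_basis p rs.length (R ⧸ Ideal.span {x}) hF' rs rfl
    hrs.toIsWeaklyRegular hspan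
  choose z hz using fun i => Ideal.Quotient.mk_surjective (w i)
  have hwz : w = fun i => Ideal.Quotient.mk (Ideal.span {x}) (z i) := funext fun i => (hz i).symm
  rw [hwz] at hw
  have hxm : x ∈ IsLocalRing.maximalIdeal R := by
    rw [IsLocalRing.mem_maximalIdeal]
    intro hu
    have h1 : Ideal.span {x} = ⊤ := Ideal.span_singleton_eq_top.mpr hu
    exact Ideal.Quotient.nontrivial_iff.mp inferInstance h1
  have hR := basis_step p hF x hxm (fun a b h => mul_left_cancel₀ hx0 h) z hw
  obtain ⟨mu, t, ht⟩ := key_lemma p e x z (bij_pow p _ hw e).1 (bij_pow p _ hR e) g (by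
    intro D hD h1
    have h2 := (pow_dvd_pow x hlt).trans (hn1 D hD h1)
    rw [hDf D hD h1, Nat.succ_eq_add_one, pow_succ] at h2
    exact (mul_dvd_mul_iff_left (pow_ne_zero _ hx0)).mp h2)
  have h5 := ha2 (a + 1) ⟨lam + x ^ a * mu, t, by
    have h6 : g = mu ^ p ^ e + x ^ p ^ e * t := by rw [← ht]; ring
    rw [add_pow_char_pow, hfg, h6]
    ring⟩
  omega
end
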